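/- (Corollary 2) Let p_1 < p_2 be distinct primes, q = p_1 p_2, m_1, m_2 ≥ 2, m = m_1+m_2, L = p_1^{m_1} p_2^{m_2}, and let 0 ≤ n_1 ≤ m_1−1, 0 ≤ n_2 ≤ m_2−1, with J_1 = {j_1,…,j_{n_1}} ⊆ {1,…,m_1} and J_2 = {j'_1,…,j'_{n_2}} ⊆ {m_1+1,…,m}. Fix functions f_1,…,f_{m_1−n_1−1}, f'_1,…,f'_{m_1−n_1−1}, h_1,…,h_{m_2−n_2−1}, h'_1,…,h'_{m_2−n_2−1} : ℤ_q → ℤ_q. For each c ∈ {0,…,p_1−1}^{n_1} × {0,…,p_2−1}^{n_2} choose bijections π_c : {1,…,m_1−n_1} → {1,…,m_1} \ J_1 and π'_c : {1,…,m_2−n_2} → {m_1+1,…,m} \ J_2, functions f^{(c)}, h^{(c)}, g^{(c)}_α (1 ≤ α ≤ m_1−n_1), g'^{(c)}_β (1 ≤ β ≤ m_2−n_2) : ℤ_q → ℤ_q and γ_c ∈ ℤ_q, and define f on the mixed-radix digit vectors so that whenever the J-coordinates of x equal c one has f(x) = (q/p_1)∑_{i=1}^{m_1−n_1−1} f_i(x_{π_c(i)})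 f'_i(x_{π_c(i+1)}) + ∑_{α=1}^{m_1−n_1} g^{(c)}_α(x_{π_c(α)}) + (q/p_2)∑_{j=1}^{m_2−n_2−1} h_j(x_{π'_c(j)}) h'_j(x_{π'_c(j+1)}) + ∑_{β=1}^{m_2−n_2} g'^{(c)}_β(x_{π'_c(β)}) + γ_c·f^{(c)}(x_{π_c(m_1−n_1)})·h^{(c)}(x_{π'_c(1)}). For t = t_2·p_1^{n_1+1} + t_1 with t_1 ∈ {0,…,p_1^{n_1+1}−1}, t_2 ∈ {0,…,p_2^{n_2+1}−1}, writing base-p_1 digits (t_{1,1},…,t_{1,n_1+1}) of t_1 and base-p_2 digits (t_{2,1},…,t_{2,n_2+1}) of t_2, let ψ(C_t) be the code whose sequences, indexed by (d_1, d_{1,n_1+1}, d_2, d_{2,n_2+1}) ∈ {0,…,p_1−1}^{n_1}×{0,…,p_1−1}×{0,…,p_2−1}^{n_2}×{0,…,p_2−1}, have x-th entry ξ_q^{f(x) + (q/p_1)[∑_{i=1}^{n_1}(d_{1,i}+t_{1,i})x_{j_i} + d_{1,n_1+1}x_{π(1)} + t_{1,n_1+1}x_{π(m_1−n_1)}] +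 (q/p_2)[∑_{i=1}^{n_2}(d_{2,i}+t_{2,i})x_{j'_i} + d_{2,n_2+1}x_{π'(1)} + t_{2,n_2+1}x_{π'(m_2−n_2)}]}, where π = π_c and π' = π'_c on the region where the J-coordinates of x equal c. Then the following are equivalent: (a) for every choice of the f^{(c)}, h^{(c)}, g^{(c)}_α, g'^{(c)}_β, γ_c, π_c, π'_c, the family {ψ(C_t) : 0 ≤ t < p_1^{n_1+1} p_2^{n_2+1}} is a (p_1^{n_1+1} p_2^{n_2+1}, L)-CCC; (b) every f_i, f'_i permutes {0,…,p_1−1} under reduction modulo p_1 and every h_j, h'_j permutes {0,…,p_2−1} under reduction modulo p_2. -/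

import Mathlib

open scoped Classical

/-- Aperiodic cross-correlation function (ACCF) of two length-`L` complex sequences
at integer shift `τ`:
`Θ(a,b)(τ) = ∑_{t=0}^{L−τ−1} a_t · conj(b_{t+τ})` for `0 ≤ τ`, and
`Θ(a,b)(τ) = ∑_{t=0}^{L+τ−1} a_{t−τ} · conj(b_t)` for `τ < 0`. -/
noncomputable def accf (L : ℕ) (a b : ℕ → ℂ) (τ : ℤ) : ℂ :=
  if 0 ≤ τ then
    ∑ t ∈ Finset.range (L - τ.toNat), a t * (starRingEnd ℂ) (b (t + τ.toNat))
  else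
    ∑ t ∈ Finset.range (L - (-τ).toNat), a (t + (-τ).toNat) * (starRingEnd ℂ) (b t)

/-- ACCF (sum) of two codes, i.e. tuples of length-`L` sequences indexed by `κ`:
`Θ(C, C')(τ) = ∑_m Θ(c^m, c'^m)(τ)`. -/
noncomputable def codeACCF {κ : Type*} [Fintype κ] (L : ℕ) (C C' : κ → ℕ → ℂ)
    (τ : ℤ) : ℂ :=
  ∑ m : κ, accf L (C m) (C' m) τ

/-- A family of codes `C_k` (`k : ι`), each a (`card κ`)-tuple of length-`L` sequences,
is a set of complete complementary codes (CCC) if the number of sequences per code equals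
the number `K` of codes, `Θ(C_{k₁}, C_{k₂})(0) = K·L`, and all other aperiodic
auto/cross-correlation sums with `|τ| < L` vanish. -/
noncomputable def IsCCC {ι κ : Type*} [Fintype ι] [Fintype κ] (L : ℕ)
    (C : ι → κ → ℕ → ℂ) : Prop :=
  Fintype.card κ = Fintype.card ι ∧
  ∀ k₁ k₂ : ι, ∀ τ : ℤ, |τ| < (L : ℤ) →
    codeACCF L (C k₁) (C k₂) τ =
      if τ = 0 ∧ k₁ = k₂ then ((Fintype.card ι : ℂ) * (L : ℂ)) else 0

/-- `ξ_q = exp(2πi/q)`, a primitive `q`-th root of unity. -/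
noncomputable def xi (q : ℕ) : ℂ := Complex.exp (2 * Real.pi * Complex.I / q)

/-- Mixed-radix digits of `x ∈ {0,…,p₁^{m₁}p₂^{m₂}−1}` (with `x = σ₁ + σ₂·p₁^{m₁}`):
for a 0-based position `j`, the digit is the `(j+1)`-st base-`p₁` digit of `σ₁` if
`j < m₁`, and the `(j−m₁+1)`-st base-`p₂` digit of `σ₂` otherwise. -/
def mdig (p₁ p₂ m₁ x j : ℕ) : ℕ :=
  if j < m₁ then x % p₁ ^ m₁ / p₁ ^ j % p₁
  else x / p₁ ^ m₁ / p₂ ^ (j - m₁) % p₂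

/-- Mixed-radix digit regarded as an element of `ℤ_q`. -/
def mdigZ (q p₁ p₂ m₁ x j : ℕ) : ZMod q := ((mdig p₁ p₂ m₁ x j : ℕ) : ZMod q)

/-- `φ : ℤ_q → ℤ_q` permutes `{0,…,p−1}` under reduction modulo `p`: the map sending
`u ∈ {0,…,p−1}` to `φ(u) mod p` is a bijection onto `ℤ_p`. -/
def PermutesMod (q p : ℕ) (φ : ZMod q → ZMod q) : Prop :=
  Function.Bijective (fun u : Fin p => (((φ ((u : ℕ) : ZMod q)).val : ℕ) : ZMod p))

/-- The function `f(x_1,…,x_m)` of Theorem 2 (two primes, `q = p₁p₂`, `m = m₁ + m₂`),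
evaluated on the mixed-radix digit vector of `x`:
`f = (q/p₁)∑ f_i(x_{π(i)})f'_i(x_{π(i+1)}) + ∑ g_α(x_α)
   + (q/p₂)∑ h_j(x_{π'(m₁+j)})h'_j(x_{π'(m₁+j+1)}) + ∑ g'_β(x_{β+m₁})
   + γ·f₀(x_{π(m₁)})·h₀(x_{π'(m₁+1)})`,
where `π` permutes the first block of `m₁` positions and `π'` the second block of
`m₂` positions (encoded as a permutation of the offsets within the block). -/
def f2 (p₁ p₂ m₁ m₂ : ℕ) (hm₁ : 2 ≤ m₁) (hm₂ : 2 ≤ m₂)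
    (fi f'i : Fin (m₁ - 1) → ZMod (p₁ * p₂) → ZMod (p₁ * p₂))
    (hj h'j : Fin (m₂ - 1) → ZMod (p₁ * p₂) → ZMod (p₁ * p₂))
    (f₀ h₀ : ZMod (p₁ * p₂) → ZMod (p₁ * p₂))
    (g : Fin m₁ → ZMod (p₁ * p₂) → ZMod (p₁ * p₂))
    (g' : Fin m₂ → ZMod (p₁ * p₂) → ZMod (p₁ * p₂))
    (γ : ZMod (p₁ * p₂)) (π : Equiv.Perm (Fin m₁)) (π' : Equiv.Perm (Fin m₂))
    (x : ℕ) : ZMod (p₁ * p₂) :=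
  let D : ℕ → ZMod (p₁ * p₂) := fun j => mdigZ (p₁ * p₂) p₁ p₂ m₁ x j
  ((p₁ * p₂ / p₁ : ℕ) : ZMod (p₁ * p₂)) *
      (∑ i : Fin (m₁ - 1),
        fi i (D (π (Fin.castLE (by omega) i))) *
          f'i i (D (π (Fin.cast (by omega) i.succ)))) +
    (∑ α : Fin m₁, g α (D α)) +
    ((p₁ * p₂ / p₂ : ℕ) : ZMod (p₁ * p₂)) *
      (∑ j : Fin (m₂ - 1),
        hj j (D (m₁ + π' (Fin.castLE (by omega) j))) *
          h'j j (D (m₁ + π' (Fin.cast (by omega) j.succ)))) +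
    (∑ β : Fin m₂, g' β (D (m₁ + β))) +
    γ * f₀ (D (π ⟨m₁ - 1, by omega⟩)) * h₀ (D (m₁ + π' ⟨0, by omega⟩))

/-- The code `ψ(C_t)` of Theorem 2, for `t = p₁·t₂ + t₁` (`t₁ = t % p₁`,
`t₂ = t / p₁`): its sequences are indexed by `(d₁, d₂) ∈ {0,…,p₁−1}×{0,…,p₂−1}` and
have `x`-th entry
`ξ_q^{f(x) + (q/p₁)(d₁x_{π(1)} + t₁x_{π(m₁)}) + (q/p₂)(d₂x_{π'(m₁+1)} + t₂x_{π'(m)})}`. -/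
noncomputable def psi2 (p₁ p₂ m₁ m₂ : ℕ) (hm₁ : 2 ≤ m₁) (hm₂ : 2 ≤ m₂)
    (fi f'i : Fin (m₁ - 1) → ZMod (p₁ * p₂) → ZMod (p₁ * p₂))
    (hj h'j : Fin (m₂ - 1) → ZMod (p₁ * p₂) → ZMod (p₁ * p₂))
    (f₀ h₀ : ZMod (p₁ * p₂) → ZMod (p₁ * p₂))
    (g : Fin m₁ → ZMod (p₁ * p₂) → ZMod (p₁ * p₂))
    (g' : Fin m₂ → ZMod (p₁ * p₂) → ZMod (p₁ * p₂))
    (γ : ZMod (p₁ * p₂)) (π : Equiv.Perm (Fin m₁)) (π' : Equiv.Perm (Fin m₂))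
    (t : ℕ) : Fin p₁ × Fin p₂ → ℕ → ℂ :=
  fun d x =>
    let D : ℕ → ZMod (p₁ * p₂) := fun j => mdigZ (p₁ * p₂) p₁ p₂ m₁ x j
    xi (p₁ * p₂) ^
      (f2 p₁ p₂ m₁ m₂ hm₁ hm₂ fi f'i hj h'j f₀ h₀ g g' γ π π' x +
          ((p₁ * p₂ / p₁ : ℕ) : ZMod (p₁ * p₂)) *
            (((d.1 : ℕ) : ZMod (p₁ * p₂)) * D (π ⟨0, by omega⟩) +
              ((t % p₁ : ℕ) : ZMod (p₁ * p₂)) * D (π ⟨m₁ - 1, by omega⟩)) +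
          ((p₁ * p₂ / p₂ : ℕ) : ZMod (p₁ * p₂)) *
            (((d.2 : ℕ) : ZMod (p₁ * p₂)) * D (m₁ + π' ⟨0, by omega⟩) +
              ((t / p₁ : ℕ) : ZMod (p₁ * p₂)) * D (m₁ + π' ⟨m₂ - 1, by omega⟩))).val

/-- The restricted function of Corollary 2 (two primes, `q = p₁p₂`,
blocks of sizes `m₁, m₂`, restricted at the `n₁ + n₂` positions listed by
`J₁`, `J₂`), evaluated on the mixed-radix digit vector of `x`: whenever the
`J`-coordinates of `x` equal `c`,
`f(x) = (q/p₁)∑ f_i(x_{π_c(i)})f'_i(x_{π_c(i+1)}) + ∑ g^{(c)}_α(x_{π_c(α)})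
      + (q/p₂)∑ h_j(x_{π'_c(j)})h'_j(x_{π'_c(j+1)}) + ∑ g'^{(c)}_β(x_{π'_c(β)})
      + γ_c·f^{(c)}(x_{π_c(m₁−n₁)})·h^{(c)}(x_{π'_c(1)})`. -/
def f2r (p₁ p₂ m₁ m₂ n₁ n₂ : ℕ) (hm₁ : 2 ≤ m₁) (hm₂ : 2 ≤ m₂)
    (hn₁ : n₁ ≤ m₁ - 1) (hn₂ : n₂ ≤ m₂ - 1)
    (J₁ : Fin n₁ → Fin m₁) (J₂ : Fin n₂ → Fin m₂)
    (fi f'i : Fin (m₁ - n₁ - 1) → ZMod (p₁ * p₂) → ZMod (p₁ * p₂))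
    (hj h'j : Fin (m₂ - n₂ - 1) → ZMod (p₁ * p₂) → ZMod (p₁ * p₂))
    (πc : ((Fin n₁ → ℕ) × (Fin n₂ → ℕ)) → Fin (m₁ - n₁) → Fin m₁)
    (π'c : ((Fin n₁ → ℕ) × (Fin n₂ → ℕ)) → Fin (m₂ - n₂) → Fin m₂)
    (gc : ((Fin n₁ → ℕ) × (Fin n₂ → ℕ)) → Fin (m₁ - n₁) →
      ZMod (p₁ * p₂) → ZMod (p₁ * p₂))
    (g'c : ((Fin n₁ → ℕ) × (Fin n₂ → ℕ)) → Fin (m₂ - n₂) →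
      ZMod (p₁ * p₂) → ZMod (p₁ * p₂))
    (fc hc : ((Fin n₁ → ℕ) × (Fin n₂ → ℕ)) → ZMod (p₁ * p₂) → ZMod (p₁ * p₂))
    (γc : ((Fin n₁ → ℕ) × (Fin n₂ → ℕ)) → ZMod (p₁ * p₂)) (x : ℕ) :
    ZMod (p₁ * p₂) :=
  let D : ℕ → ZMod (p₁ * p₂) := fun j => mdigZ (p₁ * p₂) p₁ p₂ m₁ x j
  let c : (Fin n₁ → ℕ) × (Fin n₂ → ℕ) :=
    (fun i => mdig p₁ p₂ m₁ x (J₁ i), fun i => mdig p₁ p₂ m₁ x (m₁ + J₂ i))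
  ((p₁ * p₂ / p₁ : ℕ) : ZMod (p₁ * p₂)) *
      (∑ i : Fin (m₁ - n₁ - 1),
        fi i (D (πc c (Fin.castLE (by omega) i))) *
          f'i i (D (πc c (Fin.cast (by omega) i.succ)))) +
    (∑ α : Fin (m₁ - n₁), gc c α (D (πc c α))) +
    ((p₁ * p₂ / p₂ : ℕ) : ZMod (p₁ * p₂)) *
      (∑ j : Fin (m₂ - n₂ - 1),
        hj j (D (m₁ + π'c c (Fin.castLE (by omega) j))) *
          h'j j (D (m₁ + π'c c (Fin.cast (by omega) j.succ)))) +
    (∑ β : Fin (m₂ - n₂), g'c c β (D (m₁ + π'c c β))) +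
    γc c * fc c (D (πc c ⟨m₁ - n₁ - 1, by omega⟩)) *
      hc c (D (m₁ + π'c c ⟨0, by omega⟩))

/-- The code `ψ(C_t)` of Corollary 2, for `t = t₂·p₁^{n₁+1} + t₁`
(`t₁ = t % p₁^{n₁+1}`, `t₂ = t / p₁^{n₁+1}`, with base-`p₁` digits `t_{1,v}` of `t₁`
and base-`p₂` digits `t_{2,v}` of `t₂`): its sequences are indexed by
`(d₁, d_{1,n₁+1}, d₂, d_{2,n₂+1})` and have `x`-th entry
`ξ_q^{f(x) + (q/p₁)[∑(d_{1,v}+t_{1,v})x_{j_v} + d_{1,n₁+1}x_{π_c(1)} + t_{1,n₁+1}x_{π_c(m₁−n₁)}]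
           + (q/p₂)[∑(d_{2,v}+t_{2,v})x_{j'_v} + d_{2,n₂+1}x_{π'_c(1)} + t_{2,n₂+1}x_{π'_c(m₂−n₂)}]}`. -/
noncomputable def psi2r (p₁ p₂ m₁ m₂ n₁ n₂ : ℕ) (hm₁ : 2 ≤ m₁) (hm₂ : 2 ≤ m₂)
    (hn₁ : n₁ ≤ m₁ - 1) (hn₂ : n₂ ≤ m₂ - 1)
    (J₁ : Fin n₁ → Fin m₁) (J₂ : Fin n₂ → Fin m₂)
    (fi f'i : Fin (m₁ - n₁ - 1) → ZMod (p₁ * p₂) → ZMod (p₁ * p₂))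
    (hj h'j : Fin (m₂ - n₂ - 1) → ZMod (p₁ * p₂) → ZMod (p₁ * p₂))
    (πc : ((Fin n₁ → ℕ) × (Fin n₂ → ℕ)) → Fin (m₁ - n₁) → Fin m₁)
    (π'c : ((Fin n₁ → ℕ) × (Fin n₂ → ℕ)) → Fin (m₂ - n₂) → Fin m₂)
    (gc : ((Fin n₁ → ℕ) × (Fin n₂ → ℕ)) → Fin (m₁ - n₁) →
      ZMod (p₁ * p₂) → ZMod (p₁ * p₂))
    (g'c : ((Fin n₁ → ℕ) × (Fin n₂ → ℕ)) → Fin (m₂ - n₂) →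
      ZMod (p₁ * p₂) → ZMod (p₁ * p₂))
    (fc hc : ((Fin n₁ → ℕ) × (Fin n₂ → ℕ)) → ZMod (p₁ * p₂) → ZMod (p₁ * p₂))
    (γc : ((Fin n₁ → ℕ) × (Fin n₂ → ℕ)) → ZMod (p₁ * p₂)) (t : ℕ) :
    ((Fin n₁ → Fin p₁) × Fin p₁ × (Fin n₂ → Fin p₂) × Fin p₂) → ℕ → ℂ :=
  fun d x =>
    let D : ℕ → ZMod (p₁ * p₂) := fun j => mdigZ (p₁ * p₂) p₁ p₂ m₁ x j
    let c : (Fin n₁ → ℕ) × (Fin n₂ → ℕ) :=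
      (fun i => mdig p₁ p₂ m₁ x (J₁ i), fun i => mdig p₁ p₂ m₁ x (m₁ + J₂ i))
    xi (p₁ * p₂) ^
      (f2r p₁ p₂ m₁ m₂ n₁ n₂ hm₁ hm₂ hn₁ hn₂ J₁ J₂ fi f'i hj h'j πc π'c gc g'c
          fc hc γc x +
        ((p₁ * p₂ / p₁ : ℕ) : ZMod (p₁ * p₂)) *
          ((∑ v : Fin n₁,
              (((d.1 v : ℕ) : ZMod (p₁ * p₂)) +
                ((t % p₁ ^ (n₁ + 1) / p₁ ^ (v : ℕ) % p₁ : ℕ) : ZMod (p₁ * p₂))) *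
                D (J₁ v)) +
            ((d.2.1 : ℕ) : ZMod (p₁ * p₂)) * D (πc c ⟨0, by omega⟩) +
            ((t % p₁ ^ (n₁ + 1) / p₁ ^ n₁ % p₁ : ℕ) : ZMod (p₁ * p₂)) *
              D (πc c ⟨m₁ - n₁ - 1, by omega⟩)) +
        ((p₁ * p₂ / p₂ : ℕ) : ZMod (p₁ * p₂)) *
          ((∑ v : Fin n₂,
              (((d.2.2.1 v : ℕ) : ZMod (p₁ * p₂)) +
                ((t / p₁ ^ (n₁ + 1) / p₂ ^ (v : ℕ) % p₂ : ℕ) : ZMod (p₁ * p₂))) *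
                D (m₁ + J₂ v)) +
            ((d.2.2.2 : ℕ) : ZMod (p₁ * p₂)) * D (m₁ + π'c c ⟨0, by omega⟩) +
            ((t / p₁ ^ (n₁ + 1) / p₂ ^ n₂ % p₂ : ℕ) : ZMod (p₁ * p₂)) *
              D (m₁ + π'c c ⟨m₂ - n₂ - 1, by omega⟩))).val

/-- The radix of the digit at position `j`. -/
def radix (p₁ p₂ m₁ j : ℕ) : ℕ := if j < m₁ then p₁ else p₂

/-- The place value of the digit at position `j`. -/
def placeValue (p₁ p₂ m₁ j : ℕ) : ℕ :=
  if j < m₁ then p₁ ^ j else p₁ ^ m₁ * p₂ ^ (j - m₁)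

theorem mdig_lt {p₁ p₂ : ℕ} (hp₁ : 0 < p₁) (hp₂ : 0 < p₂) (m₁ x j : ℕ) :
    mdig p₁ p₂ m₁ x j < radix p₁ p₂ m₁ j := by
  unfold mdig radix
  split_ifs
  · exact Nat.mod_lt _ hp₁
  · exact Nat.mod_lt _ hp₂

theorem mod_pow_eq_sum (p x m : ℕ) :
    x % p ^ m = ∑ j ∈ Finset.range m, x / p ^ j % p * p ^ j := by
  induction m with
  | zero => simp [Nat.mod_one]
  | succ m ih => rw [Finset.sum_range_succ, ← ih, Nat.mod_pow_succ]; ring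

theorem eq_sum_mdig {p₁ p₂ m₁ m₂ x : ℕ} (hx : x < p₁ ^ m₁ * p₂ ^ m₂) :
    x = ∑ j ∈ Finset.range (m₁ + m₂), mdig p₁ p₂ m₁ x j * placeValue p₁ p₂ m₁ j := by
  have h1 : ∑ j ∈ Finset.range m₁, mdig p₁ p₂ m₁ x j * placeValue p₁ p₂ m₁ j
      = x % p₁ ^ m₁ := by
    conv_rhs => rw [← Nat.mod_mod, mod_pow_eq_sum]
    refine Finset.sum_congr rfl fun j hj => ?_
    have := Finset.mem_range.1 hj
    simp [mdig, placeValue, this]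
  have h2 : ∑ j ∈ Finset.range m₂,
      mdig p₁ p₂ m₁ x (m₁ + j) * placeValue p₁ p₂ m₁ (m₁ + j) = p₁ ^ m₁ * (x / p₁ ^ m₁) := by
    have h3 : x / p₁ ^ m₁ < p₂ ^ m₂ := Nat.div_lt_of_lt_mul hx
    conv_rhs => rw [← Nat.mod_eq_of_lt h3, mod_pow_eq_sum, Finset.mul_sum]
    refine Finset.sum_congr rfl fun j hj => ?_
    simp [mdig, placeValue]
    ring
  rw [Finset.sum_range_add, h1, h2, Nat.mod_add_div]

theorem eq_of_mdig_eq {p₁ p₂ m₁ m₂ x y : ℕ} (hx : x < p₁ ^ m₁ * p₂ ^ m₂)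
    (hy : y < p₁ ^ m₁ * p₂ ^ m₂)
    (h : ∀ j < m₁ + m₂, mdig p₁ p₂ m₁ x j = mdig p₁ p₂ m₁ y j) : x = y := by
  rw [eq_sum_mdig hx, eq_sum_mdig hy]
  refine Finset.sum_congr rfl fun j hj => ?_
  rw [h j (Finset.mem_range.1 hj)]

theorem prod_radix (p₁ p₂ m₁ m₂ : ℕ) :
    ∏ j : Fin (m₁ + m₂), radix p₁ p₂ m₁ j = p₁ ^ m₁ * p₂ ^ m₂ := by
  rw [Fin.prod_univ_add]
  simp [radix]

theorem exists_mdig_eq {p₁ p₂ : ℕ} (hp₁ : 0 < p₁) (hp₂ : 0 < p₂) (m₁ m₂ : ℕ) (d : ℕ → ℕ)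
    (hd : ∀ j < m₁ + m₂, d j < radix p₁ p₂ m₁ j) :
    ∃ x < p₁ ^ m₁ * p₂ ^ m₂, ∀ j < m₁ + m₂, mdig p₁ p₂ m₁ x j = d j := by
  have hs := Finset.surjOn_of_injOn_of_card_le
    (s := Finset.range (p₁ ^ m₁ * p₂ ^ m₂))
    (t := Fintype.piFinset fun j : Fin (m₁ + m₂) => Finset.range (radix p₁ p₂ m₁ j))
    (fun x (j : Fin (m₁ + m₂)) => mdig p₁ p₂ m₁ x j)
    (fun x _ => by simpa using fun j : Fin (m₁ + m₂) => mdig_lt hp₁ hp₂ m₁ x j)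
    (fun x hx y hy h => eq_of_mdig_eq (by simpa using hx) (by simpa using hy)
      fun j hj => congrFun h ⟨j, hj⟩)
    (by simp [prod_radix])
  have hmem : (fun j : Fin (m₁ + m₂) => d j) ∈
      ((Fintype.piFinset fun j : Fin (m₁ + m₂) => Finset.range (radix p₁ p₂ m₁ j) :
        Finset (Fin (m₁ + m₂) → ℕ)) : Set (Fin (m₁ + m₂) → ℕ)) := by
    simpa using fun j : Fin (m₁ + m₂) => hd j j.2
  obtain ⟨x, hx, hxd⟩ := hs hmem
  exact ⟨x, by simpa using hx, fun j hj => congrFun hxd ⟨j, hj⟩⟩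

/-- Replace the digit of `x` at position `j` by `u`. -/
def setDigit (p₁ p₂ m₁ m₂ x j u : ℕ) : ℕ :=
  ∑ i ∈ Finset.range (m₁ + m₂),
    Function.update (mdig p₁ p₂ m₁ x) j u i * placeValue p₁ p₂ m₁ i

theorem setDigit_spec {p₁ p₂ m₁ m₂ : ℕ} (hp₁ : 0 < p₁) (hp₂ : 0 < p₂) (x : ℕ) {j u : ℕ}
    (hu : u < radix p₁ p₂ m₁ j) :
    setDigit p₁ p₂ m₁ m₂ x j u < p₁ ^ m₁ * p₂ ^ m₂ ∧
      ∀ i < m₁ + m₂, mdig p₁ p₂ m₁ (setDigit p₁ p₂ m₁ m₂ x j u) i =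
        Function.update (mdig p₁ p₂ m₁ x) j u i := by
  obtain ⟨z, hz, hzd⟩ := exists_mdig_eq hp₁ hp₂ m₁ m₂
    (Function.update (mdig p₁ p₂ m₁ x) j u) (fun i _ => by
      rcases eq_or_ne i j with rfl | hij
      · simpa using hu
      · simpa [hij] using mdig_lt hp₁ hp₂ m₁ x i)
  have : setDigit p₁ p₂ m₁ m₂ x j u = z := by
    rw [eq_sum_mdig hz, setDigit]
    exact Finset.sum_congr rfl fun i hi => by rw [hzd i (Finset.mem_range.1 hi)]
  rw [this]
  exact ⟨hz, hzd⟩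

theorem setDigit_sub_setDigit {p₁ p₂ m₁ m₂ x y j : ℕ} (hx : x < p₁ ^ m₁ * p₂ ^ m₂)
    (hy : y < p₁ ^ m₁ * p₂ ^ m₂) (hxy : mdig p₁ p₂ m₁ x j = mdig p₁ p₂ m₁ y j) (u : ℕ) :
    (setDigit p₁ p₂ m₁ m₂ y j u : ℤ) - setDigit p₁ p₂ m₁ m₂ x j u = y - x := by
  conv_rhs => rw [eq_sum_mdig hx, eq_sum_mdig hy]
  simp only [setDigit, Nat.cast_sum, Nat.cast_mul, ← Finset.sum_sub_distrib]
  refine Finset.sum_congr rfl fun i _ => ?_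
  rcases eq_or_ne i j with rfl | hij
  · simp [hxy]
  · simp [hij]

theorem setDigit_setDigit {p₁ p₂ m₁ m₂ : ℕ} (hp₁ : 0 < p₁) (hp₂ : 0 < p₂) {x j u : ℕ}
    (hx : x < p₁ ^ m₁ * p₂ ^ m₂) (hu : u < radix p₁ p₂ m₁ j) :
    setDigit p₁ p₂ m₁ m₂ (setDigit p₁ p₂ m₁ m₂ x j u) j (mdig p₁ p₂ m₁ x j) = x := by
  have h1 := setDigit_spec (m₂ := m₂) hp₁ hp₂ x hu
  have h2 := setDigit_spec (m₂ := m₂) hp₁ hp₂ (setDigit p₁ p₂ m₁ m₂ x j u)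
    (mdig_lt hp₁ hp₂ m₁ x j)
  refine eq_of_mdig_eq h2.1 hx fun i hi => ?_
  rw [h2.2 i hi]
  rcases eq_or_ne i j with rfl | hij
  · simp
  · simp [hij, h1.2 i hi]

/-- Averaging over a common digit of all pairs in a set that is stable under changing it. -/
theorem sum_sum_setDigit {p₁ p₂ m₁ m₂ : ℕ} (hp₁ : 0 < p₁) (hp₂ : 0 < p₂) {j : ℕ}
    (hj : j < m₁ + m₂) (S : Finset (ℕ × ℕ)) (F : ℕ → ℕ → ℂ)
    (hlt : ∀ z ∈ S, z.1 < p₁ ^ m₁ * p₂ ^ m₂ ∧ z.2 < p₁ ^ m₁ * p₂ ^ m₂)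
    (heq : ∀ z ∈ S, mdig p₁ p₂ m₁ z.1 j = mdig p₁ p₂ m₁ z.2 j)
    (hS : ∀ z ∈ S, ∀ u < radix p₁ p₂ m₁ j,
      (setDigit p₁ p₂ m₁ m₂ z.1 j u, setDigit p₁ p₂ m₁ m₂ z.2 j u) ∈ S) :
    ∑ z ∈ S, ∑ u ∈ Finset.range (radix p₁ p₂ m₁ j),
        F (setDigit p₁ p₂ m₁ m₂ z.1 j u) (setDigit p₁ p₂ m₁ m₂ z.2 j u) =
      radix p₁ p₂ m₁ j * ∑ z ∈ S, F z.1 z.2 := by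
  have h : (radix p₁ p₂ m₁ j : ℂ) * ∑ z ∈ S, F z.1 z.2 =
      ∑ z ∈ S, ∑ u ∈ Finset.range (radix p₁ p₂ m₁ j), F z.1 z.2 := by
    simp [Finset.mul_sum]
  rw [h, ← Finset.sum_product', ← Finset.sum_product']
  let φ : (ℕ × ℕ) × ℕ → (ℕ × ℕ) × ℕ := fun w =>
    ((setDigit p₁ p₂ m₁ m₂ w.1.1 j w.2, setDigit p₁ p₂ m₁ m₂ w.1.2 j w.2),
      mdig p₁ p₂ m₁ w.1.1 j)
  have hmaps : ∀ w ∈ S ×ˢ Finset.range (radix p₁ p₂ m₁ j),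
      φ w ∈ S ×ˢ Finset.range (radix p₁ p₂ m₁ j) := by
    rintro ⟨z, u⟩ hw
    simp only [Finset.mem_product, Finset.mem_range] at hw
    simp only [Finset.mem_product, Finset.mem_range, φ]
    exact ⟨hS z hw.1 u hw.2, mdig_lt hp₁ hp₂ _ _ _⟩
  have hinv : ∀ w ∈ S ×ˢ Finset.range (radix p₁ p₂ m₁ j), φ (φ w) = w := by
    rintro ⟨⟨x, y⟩, u⟩ hw
    simp only [Finset.mem_product, Finset.mem_range] at hw
    obtain ⟨hx, hy⟩ := hlt _ hw.1
    have he := heq _ hw.1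
    have hd := (setDigit_spec (m₂ := m₂) hp₁ hp₂ x hw.2).2 j hj
    simp only at hx hy he
    simp only [φ, hd, setDigit_setDigit hp₁ hp₂ hx hw.2]
    rw [he, setDigit_setDigit hp₁ hp₂ hy hw.2]
    simp
  exact Finset.sum_bij' (fun w _ => φ w) (fun w _ => φ w) hmaps hmaps hinv hinv
    (fun _ _ => rfl)

theorem stdAddChar_sum {ι : Type*} {q : ℕ} [NeZero q] (s : Finset ι) (f : ι → ZMod q) :
    ZMod.stdAddChar (∑ i ∈ s, f i) = ∏ i ∈ s, ZMod.stdAddChar (f i) := by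
  induction s using Finset.induction_on with
  | empty => simp
  | insert a s ha ih =>
    rw [Finset.sum_insert ha, Finset.prod_insert ha, AddChar.map_add_eq_mul, ih]

theorem conj_stdAddChar {q : ℕ} [NeZero q] (z : ZMod q) :
    (starRingEnd ℂ) (ZMod.stdAddChar z) = ZMod.stdAddChar (-z) := by
  rw [ZMod.stdAddChar_apply, ZMod.stdAddChar_apply, AddChar.map_neg_eq_inv, Circle.coe_inv_eq_conj]

theorem xi_pow_val (q : ℕ) [NeZero q] (z : ZMod q) : xi q ^ z.val = ZMod.stdAddChar z := by
  conv_rhs => rw [← ZMod.natCast_zmod_val z, ← Int.cast_natCast, ZMod.stdAddChar_coe]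
  rw [xi, ← Complex.exp_nat_mul]
  congr 1
  push_cast
  ring

theorem stdAddChar_div_mul {q p : ℕ} [NeZero q] [NeZero p] (h : p ∣ q) (z : ZMod q) :
    ZMod.stdAddChar (((q / p : ℕ) : ZMod q) * z) =
      ZMod.stdAddChar (ZMod.castHom h (ZMod p) z) := by
  obtain ⟨j, rfl⟩ := ZMod.intCast_surjective z
  rw [map_intCast, ZMod.stdAddChar_coe, ← Int.cast_natCast, ← Int.cast_mul, ZMod.stdAddChar_coe]
  obtain ⟨k, rfl⟩ := h
  have hp : p ≠ 0 := NeZero.ne p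
  have hk : k ≠ 0 := fun hk => NeZero.ne (p * k) (by simp [hk])
  rw [Nat.mul_div_cancel_left _ (Nat.pos_of_ne_zero hp)]
  congr 1
  have hp' : (p : ℂ) ≠ 0 := Nat.cast_ne_zero.2 hp
  have hk' : (k : ℂ) ≠ 0 := Nat.cast_ne_zero.2 hk
  push_cast
  field_simp

theorem permutesMod_iff {q p : ℕ} [NeZero q] (h : p ∣ q) (φ : ZMod q → ZMod q) :
    PermutesMod q p φ ↔
      Function.Bijective (fun u : Fin p => ZMod.castHom h (ZMod p) (φ ((u : ℕ) : ZMod q))) := by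
  unfold PermutesMod
  simp only [ZMod.natCast_val, ZMod.castHom_apply]

theorem sum_stdAddChar_of_permutesMod {q p : ℕ} [NeZero q] [NeZero p] (h : p ∣ q)
    {φ : ZMod q → ZMod q} (hφ : PermutesMod q p φ) (c : ZMod q) :
    ∑ u ∈ Finset.range p, ZMod.stdAddChar (((q / p : ℕ) : ZMod q) * (φ (u : ZMod q) * c)) =
      if ZMod.castHom h (ZMod p) c = 0 then (p : ℂ) else 0 := by
  rw [permutesMod_iff h] at hφ
  simp only [stdAddChar_div_mul h, map_mul]
  rw [Finset.sum_range (fun u : ℕ => ZMod.stdAddChar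
    (ZMod.castHom h (ZMod p) (φ (u : ZMod q)) * ZMod.castHom h (ZMod p) c))]
  rw [hφ.sum_comp (fun w : ZMod p => ZMod.stdAddChar (w * ZMod.castHom h (ZMod p) c))]
  rw [AddChar.sum_mulShift _ (ZMod.isPrimitive_stdAddChar p)]
  rw [ZMod.card]
  split_ifs <;> simp_all

theorem permutesMod_id {q p : ℕ} [NeZero q] [NeZero p] (h : p ∣ q) :
    PermutesMod q p (fun z => z) := by
  rw [permutesMod_iff h, Fintype.bijective_iff_injective_and_card]
  refine ⟨fun u v huv => ?_, by simp [ZMod.card]⟩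
  simp only [map_natCast] at huv
  rw [ZMod.natCast_eq_natCast_iff'] at huv
  rw [Nat.mod_eq_of_lt u.2, Nat.mod_eq_of_lt v.2] at huv
  exact Fin.ext huv

theorem castHom_natCast_sub_eq_zero {q p : ℕ} (h : p ∣ q) {a b : ℕ} (ha : a < p) (hb : b < p) :
    ZMod.castHom h (ZMod p) ((a : ZMod q) - b) = 0 ↔ a = b := by
  rw [map_sub, map_natCast, map_natCast, sub_eq_zero, ZMod.natCast_eq_natCast_iff',
    Nat.mod_eq_of_lt ha, Nat.mod_eq_of_lt hb]

theorem sum_stdAddChar_digit {q p : ℕ} [NeZero q] [NeZero p] (h : p ∣ q) {a b : ℕ}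
    (ha : a < p) (hb : b < p) :
    ∑ u : Fin p, ZMod.stdAddChar (((q / p : ℕ) : ZMod q) *
      (((u : ℕ) : ZMod q) * ((a : ZMod q) - (b : ZMod q)))) = if a = b then (p : ℂ) else 0 := by
  have := sum_stdAddChar_of_permutesMod h (permutesMod_id h) ((a : ZMod q) - b)
  simp only [castHom_natCast_sub_eq_zero h ha hb] at this
  rw [Finset.sum_range] at this
  exact this

theorem sum_stdAddChar_digits {q p n : ℕ} [NeZero q] [NeZero p] (h : p ∣ q) {a b : Fin n → ℕ}
    (ha : ∀ v, a v < p) (hb : ∀ v, b v < p) :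
    ∑ d : Fin n → Fin p, ZMod.stdAddChar (((q / p : ℕ) : ZMod q) *
      ∑ v, (((d v : ℕ) : ZMod q) * ((a v : ZMod q) - (b v : ZMod q)))) =
        if a = b then (p : ℂ) ^ n else 0 := by
  have h1 : ∀ d : Fin n → Fin p, ZMod.stdAddChar (((q / p : ℕ) : ZMod q) *
      ∑ v, (((d v : ℕ) : ZMod q) * ((a v : ZMod q) - (b v : ZMod q)))) =
      ∏ v, ZMod.stdAddChar (((q / p : ℕ) : ZMod q) *
        (((d v : ℕ) : ZMod q) * ((a v : ZMod q) - (b v : ZMod q)))) := fun d => by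
    rw [Finset.mul_sum, stdAddChar_sum]
  simp only [h1]
  rw [← Fintype.piFinset_univ, ← Finset.prod_univ_sum (fun _ => Finset.univ)
    (fun v (u : Fin p) => ZMod.stdAddChar (((q / p : ℕ) : ZMod q) *
        (((u : ℕ) : ZMod q) * ((a v : ZMod q) - (b v : ZMod q)))))]
  simp only [sum_stdAddChar_digit h (ha _) (hb _)]
  split_ifs with hab
  · simp [hab]
  · obtain ⟨v, hv⟩ := Function.ne_iff.1 hab
    exact Finset.prod_eq_zero (Finset.mem_univ v) (if_neg hv)

/-- If all the sums `∑ u, χ (φ u * (φ' a - φ' b))` over distinct digits `a`, `b` vanish, then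
both `φ` and `φ'` permute the digits. -/
theorem permutesMod_of_sum_eq_zero {q p : ℕ} [NeZero q] [NeZero p] (h : p ∣ q)
    {φ φ' : ZMod q → ZMod q}
    (hs : ∀ a < p, ∀ b < p, a ≠ b → ∑ u ∈ Finset.range p, ZMod.stdAddChar
      (((q / p : ℕ) : ZMod q) * (φ (u : ZMod q) * (φ' (a : ZMod q) - φ' (b : ZMod q)))) = 0) :
    PermutesMod q p φ ∧ PermutesMod q p φ' := by
  have hφ' : PermutesMod q p φ' := by
    rw [permutesMod_iff h, Fintype.bijective_iff_injective_and_card]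
    refine ⟨fun a b hab => ?_, by simp [ZMod.card]⟩
    by_contra hne
    have h0 := hs a a.2 b b.2 (fun h => hne (Fin.ext h))
    simp only [stdAddChar_div_mul h, map_mul, map_sub] at h0
    simp only at hab
    rw [hab] at h0
    simp [NeZero.ne p] at h0
  refine ⟨?_, hφ'⟩
  rw [permutesMod_iff h] at hφ' ⊢
  have hk : ∀ k : ZMod p, k ≠ 0 →
      ∑ u : Fin p, ZMod.stdAddChar (ZMod.castHom h (ZMod p) (φ ((u : ℕ) : ZMod q)) * k) = 0 := by
    intro k hk
    obtain ⟨a, ha⟩ := hφ'.2 k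
    obtain ⟨b, hb⟩ := hφ'.2 0
    simp only at ha hb
    have hab : a ≠ b := fun hab => hk (by rw [← ha, hab, hb])
    have h0 := hs a a.2 b b.2 (fun h => hab (Fin.ext h))
    simp only [stdAddChar_div_mul h, map_mul, map_sub, ha, hb, sub_zero] at h0
    rw [Finset.sum_range] at h0
    exact h0
  rw [Fintype.bijective_iff_surjective_and_card]
  refine ⟨?_, by simp [ZMod.card]⟩
  · intro w
    by_contra! hw
    have hsum : ∑ k : ZMod p, ∑ u : Fin p,
        ZMod.stdAddChar ((ZMod.castHom h (ZMod p) (φ ((u : ℕ) : ZMod q)) - w) * k) = p := by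
      rw [Finset.sum_eq_single 0]
      · simp
      · intro k _ hk0
        have : ∀ u : Fin p, ZMod.stdAddChar
            ((ZMod.castHom h (ZMod p) (φ ((u : ℕ) : ZMod q)) - w) * k) =
            ZMod.stdAddChar (ZMod.castHom h (ZMod p) (φ ((u : ℕ) : ZMod q)) * k) *
              ZMod.stdAddChar (-(w * k)) := fun u => by
          rw [← AddChar.map_add_eq_mul]; ring_nf
        simp only [this, ← Finset.sum_mul, hk k hk0, zero_mul]
      · simp
    rw [Finset.sum_comm] at hsum
    have hz : ∀ u : Fin p, ∑ k : ZMod p,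
        ZMod.stdAddChar ((ZMod.castHom h (ZMod p) (φ ((u : ℕ) : ZMod q)) - w) * k) = 0 := by
      intro u
      simp only [mul_comm _ (_ : ZMod p)]
      rw [AddChar.sum_mulShift _ (ZMod.isPrimitive_stdAddChar p),
        if_neg (sub_ne_zero.2 (hw u)), Nat.cast_zero]
    simp only [hz, Finset.sum_const_zero] at hsum
    exact NeZero.ne p (by exact_mod_cast hsum.symm)

/-- The pairs of positions compared by the aperiodic correlation at shift `τ`. -/
def shiftPairs (L : ℕ) (τ : ℤ) : Finset (ℕ × ℕ) :=
  (Finset.range L ×ˢ Finset.range L).filter fun z => (z.2 : ℤ) - z.1 = τ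

theorem accf_eq_sum_shiftPairs (L : ℕ) (a b : ℕ → ℂ) (τ : ℤ) :
    accf L a b τ = ∑ z ∈ shiftPairs L τ, a z.1 * (starRingEnd ℂ) (b z.2) := by
  unfold accf shiftPairs
  split_ifs with h
  · refine Finset.sum_bij' (fun t _ => (t, t + τ.toNat)) (fun z _ => z.1) ?_ ?_ ?_ ?_ ?_
    · intro t ht
      simp only [Finset.mem_range, Finset.mem_filter, Finset.mem_product] at ht ⊢
      omega
    · intro z hz
      simp only [Finset.mem_range, Finset.mem_filter, Finset.mem_product] at hz ⊢
      omega
    · simp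
    · rintro ⟨x, y⟩ hz
      simp only [Finset.mem_range, Finset.mem_filter, Finset.mem_product] at hz
      simp only [Prod.mk.injEq, true_and]
      omega
    · simp
  · refine Finset.sum_bij' (fun t _ => (t + (-τ).toNat, t)) (fun z _ => z.2) ?_ ?_ ?_ ?_ ?_
    · intro t ht
      simp only [Finset.mem_range, Finset.mem_filter, Finset.mem_product] at ht ⊢
      omega
    · intro z hz
      simp only [Finset.mem_range, Finset.mem_filter, Finset.mem_product] at hz ⊢
      omega
    · simp
    · rintro ⟨x, y⟩ hz
      simp only [Finset.mem_range, Finset.mem_filter, Finset.mem_product] at hz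
      simp only [Prod.mk.injEq, and_true]
      omega
    · simp

/-- Summing over the sequence index of a code keeps only the pairs on which all the digits
multiplied by that index agree. -/
theorem codeACCF_eq_sum_filter {p₁ p₂ n₁ n₂ : ℕ} [NeZero p₁] [NeZero p₂] (L : ℕ)
    (C C' : (Fin n₁ → Fin p₁) × Fin p₁ × (Fin n₂ → Fin p₂) × Fin p₂ → ℕ → ℂ)
    (Φ Φ' : ℕ → ZMod (p₁ * p₂)) (c : ℕ → (Fin n₁ → ℕ) × (Fin n₂ → ℕ)) (a b : ℕ → ℕ)
    (hc₁ : ∀ x v, (c x).1 v < p₁) (hc₂ : ∀ x v, (c x).2 v < p₂)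
    (ha : ∀ x, a x < p₁) (hb : ∀ x, b x < p₂)
    (hC : ∀ d x, C d x = ZMod.stdAddChar (Φ x +
      ((p₁ * p₂ / p₁ : ℕ) : ZMod (p₁ * p₂)) *
        (∑ v, ((d.1 v : ℕ) : ZMod (p₁ * p₂)) * ((c x).1 v : ZMod (p₁ * p₂))) +
      ((p₁ * p₂ / p₁ : ℕ) : ZMod (p₁ * p₂)) * (((d.2.1 : ℕ) : ZMod (p₁ * p₂)) * (a x : ZMod (p₁ * p₂))) +
      ((p₁ * p₂ / p₂ : ℕ) : ZMod (p₁ * p₂)) *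
        (∑ v, ((d.2.2.1 v : ℕ) : ZMod (p₁ * p₂)) * ((c x).2 v : ZMod (p₁ * p₂))) +
      ((p₁ * p₂ / p₂ : ℕ) : ZMod (p₁ * p₂)) * (((d.2.2.2 : ℕ) : ZMod (p₁ * p₂)) * (b x : ZMod (p₁ * p₂)))))
    (hC' : ∀ d x, C' d x = ZMod.stdAddChar (Φ' x +
      ((p₁ * p₂ / p₁ : ℕ) : ZMod (p₁ * p₂)) *
        (∑ v, ((d.1 v : ℕ) : ZMod (p₁ * p₂)) * ((c x).1 v : ZMod (p₁ * p₂))) +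
      ((p₁ * p₂ / p₁ : ℕ) : ZMod (p₁ * p₂)) * (((d.2.1 : ℕ) : ZMod (p₁ * p₂)) * (a x : ZMod (p₁ * p₂))) +
      ((p₁ * p₂ / p₂ : ℕ) : ZMod (p₁ * p₂)) *
        (∑ v, ((d.2.2.1 v : ℕ) : ZMod (p₁ * p₂)) * ((c x).2 v : ZMod (p₁ * p₂))) +
      ((p₁ * p₂ / p₂ : ℕ) : ZMod (p₁ * p₂)) * (((d.2.2.2 : ℕ) : ZMod (p₁ * p₂)) * (b x : ZMod (p₁ * p₂)))))
    (τ : ℤ) :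
    codeACCF L C C' τ = (p₁ ^ (n₁ + 1) * p₂ ^ (n₂ + 1) : ℕ) *
      ∑ z ∈ (shiftPairs L τ).filter
        (fun z => c z.1 = c z.2 ∧ a z.1 = a z.2 ∧ b z.1 = b z.2),
        ZMod.stdAddChar (Φ z.1 - Φ' z.2) := by
  have h₁ : p₁ ∣ p₁ * p₂ := dvd_mul_right _ _
  have h₂ : p₂ ∣ p₁ * p₂ := dvd_mul_left _ _
  simp only [codeACCF, accf_eq_sum_shiftPairs]
  rw [Finset.sum_comm, Finset.sum_filter, Finset.mul_sum]
  refine Finset.sum_congr rfl fun z _ => ?_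
  obtain ⟨x, y⟩ := z
  have key : ∀ d, C d x * (starRingEnd ℂ) (C' d y) = ZMod.stdAddChar (Φ x - Φ' y) *
      (ZMod.stdAddChar (((p₁ * p₂ / p₁ : ℕ) : ZMod (p₁ * p₂)) *
          ∑ v, ((d.1 v : ℕ) : ZMod (p₁ * p₂)) *
            (((c x).1 v : ZMod (p₁ * p₂)) - ((c y).1 v : ZMod (p₁ * p₂)))) *
        (ZMod.stdAddChar (((p₁ * p₂ / p₁ : ℕ) : ZMod (p₁ * p₂)) *
          (((d.2.1 : ℕ) : ZMod (p₁ * p₂)) * ((a x : ZMod (p₁ * p₂)) - (a y : ZMod (p₁ * p₂))))) *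
        (ZMod.stdAddChar (((p₁ * p₂ / p₂ : ℕ) : ZMod (p₁ * p₂)) *
          ∑ v, ((d.2.2.1 v : ℕ) : ZMod (p₁ * p₂)) *
            (((c x).2 v : ZMod (p₁ * p₂)) - ((c y).2 v : ZMod (p₁ * p₂)))) *
        ZMod.stdAddChar (((p₁ * p₂ / p₂ : ℕ) : ZMod (p₁ * p₂)) *
          (((d.2.2.2 : ℕ) : ZMod (p₁ * p₂)) *
            ((b x : ZMod (p₁ * p₂)) - (b y : ZMod (p₁ * p₂)))))))) := by
    intro d
    rw [hC, hC', conj_stdAddChar]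
    simp only [← AddChar.map_add_eq_mul, mul_sub, Finset.sum_sub_distrib]
    congr 1
    ring
  simp only [key, ← Finset.mul_sum, Fintype.sum_prod_type]
  simp only [← Finset.sum_mul]
  rw [sum_stdAddChar_digits h₁ (hc₁ x) (hc₁ y), sum_stdAddChar_digits h₂ (hc₂ x) (hc₂ y),
    sum_stdAddChar_digit h₁ (ha x) (ha y), sum_stdAddChar_digit h₂ (hb x) (hb y)]
  by_cases h1 : (c x).1 = (c y).1
  swap
  · have hR : ¬(c x = c y ∧ a x = a y ∧ b x = b y) := fun h => h1 (congrArg Prod.fst h.1)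
    simp only [if_neg h1, if_neg hR, mul_zero, zero_mul]
  by_cases h2 : (c x).2 = (c y).2
  swap
  · have hR : ¬(c x = c y ∧ a x = a y ∧ b x = b y) := fun h => h2 (congrArg Prod.snd h.1)
    simp only [if_neg h2, if_neg hR, mul_zero, zero_mul]
  by_cases h3 : a x = a y
  swap
  · have hR : ¬(c x = c y ∧ a x = a y ∧ b x = b y) := fun h => h3 h.2.1
    simp only [if_neg h3, if_neg hR, mul_zero, zero_mul]
  by_cases h4 : b x = b y
  swap
  · have hR : ¬(c x = c y ∧ a x = a y ∧ b x = b y) := fun h => h4 h.2.2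
    simp only [if_neg h4, if_neg hR, mul_zero]
  rw [if_pos h1, if_pos h2, if_pos h3, if_pos h4, if_pos ⟨Prod.ext h1 h2, h3, h4⟩]
  push_cast
  ring

/-- The quadratic-type form `∑ i, f_i(X_i) f'_i(X_{i+1})` along a path of digits. -/
def pathSum {q r : ℕ} (f f' : Fin (r - 1) → ZMod q → ZMod q) (X : Fin r → ZMod q) : ZMod q :=
  ∑ i : Fin (r - 1), f i (X ⟨i, by omega⟩) * f' i (X ⟨i + 1, by omega⟩)

/-- The part of `pathSum` that involves only digits after position `k`. -/
def pathTail {q r : ℕ} (f f' : Fin (r - 1) → ZMod q → ZMod q) (k : Fin (r - 1))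
    (X : Fin r → ZMod q) : ZMod q :=
  ∑ i : Fin (r - 1), if k < i then f i (X ⟨i, by omega⟩) * f' i (X ⟨i + 1, by omega⟩) else 0

theorem pathTail_congr {q r : ℕ} (f f' : Fin (r - 1) → ZMod q → ZMod q) (k : Fin (r - 1))
    {X Y : Fin r → ZMod q} (h : ∀ j : Fin r, (k : ℕ) < j → X j = Y j) :
    pathTail f f' k X = pathTail f f' k Y := by
  refine Finset.sum_congr rfl fun i _ => ?_
  split_ifs with hi
  · rw [h ⟨i, by omega⟩ hi, h ⟨i + 1, by omega⟩ (Nat.lt_succ_of_lt hi)]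
  · rfl

theorem pathSum_update_sub {q r : ℕ} (f f' : Fin (r - 1) → ZMod q → ZMod q) (k : Fin (r - 1))
    {X Y : Fin r → ZMod q} (h : ∀ j : Fin r, (j : ℕ) ≤ k → X j = Y j) (u : ZMod q) :
    pathSum f f' (Function.update X ⟨k, by omega⟩ u) -
        pathSum f f' (Function.update Y ⟨k, by omega⟩ u) =
      f k u * (f' k (X ⟨k + 1, by omega⟩) - f' k (Y ⟨k + 1, by omega⟩)) +
        (pathTail f f' k X - pathTail f f' k Y) := by
  have hk : f k u * (f' k (X ⟨k + 1, by omega⟩) - f' k (Y ⟨k + 1, by omega⟩)) =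
      ∑ i : Fin (r - 1), if i = k then
        f i u * (f' i (X ⟨i + 1, by omega⟩) - f' i (Y ⟨i + 1, by omega⟩)) else 0 := by
    simp
  rw [hk]
  unfold pathSum pathTail
  rw [← Finset.sum_sub_distrib, ← Finset.sum_sub_distrib, ← Finset.sum_add_distrib]
  refine Finset.sum_congr rfl fun i _ => ?_
  rcases lt_trichotomy i k with hi | rfl | hi
  · have hi' : (i : ℕ) < k := hi
    have h1 : (⟨i, by omega⟩ : Fin r) ≠ ⟨k, by omega⟩ := by simp; omega
    rw [Function.update_of_ne h1, Function.update_of_ne h1, h ⟨i, by omega⟩ hi'.le,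
      if_neg hi.ne, if_neg hi.not_gt, if_neg hi.not_gt]
    by_cases h2 : (i : ℕ) + 1 = k
    · have h3 : (⟨(i : ℕ) + 1, by omega⟩ : Fin r) = ⟨k, by omega⟩ := by simp [h2]
      rw [h3, Function.update_self, Function.update_self]
      ring
    · have h3 : (⟨(i : ℕ) + 1, by omega⟩ : Fin r) ≠ ⟨k, by omega⟩ := by simpa using h2
      rw [Function.update_of_ne h3, Function.update_of_ne h3, h ⟨(i : ℕ) + 1, by omega⟩ hi']
      ring
  · have h3 : (⟨(i : ℕ) + 1, by omega⟩ : Fin r) ≠ ⟨i, by omega⟩ := by simp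
    rw [Function.update_of_ne h3, Function.update_of_ne h3, Function.update_self,
      Function.update_self, if_pos rfl, if_neg (lt_irrefl _), if_neg (lt_irrefl _)]
    ring
  · have hi' : (k : ℕ) < i := hi
    have h1 : (⟨i, by omega⟩ : Fin r) ≠ ⟨k, by omega⟩ := by simp; omega
    have h3 : (⟨(i : ℕ) + 1, by omega⟩ : Fin r) ≠ ⟨k, by omega⟩ := by simp; omega
    rw [Function.update_of_ne h1, Function.update_of_ne h3, Function.update_of_ne h1,
      Function.update_of_ne h3, if_neg hi.ne', if_pos hi, if_pos hi]
    ring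

theorem sum_update_sub {q r : ℕ} (g : Fin r → ZMod q → ZMod q) {X Y : Fin r → ZMod q}
    {k : Fin r} (h : X k = Y k) (u : ZMod q) :
    ∑ α, g α (Function.update X k u α) - ∑ α, g α (Function.update Y k u α) =
      ∑ α, g α (X α) - ∑ α, g α (Y α) := by
  rw [← Finset.sum_sub_distrib, ← Finset.sum_sub_distrib]
  refine Finset.sum_congr rfl fun i _ => ?_
  rcases eq_or_ne i k with rfl | hi
  · simp [h]
  · simp [hi]

/-- The exponent of a sequence on a region where the restricted digits are constant, as a
function of the remaining digits `X`, `X'` of the two blocks. -/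
def phase {q r r' : ℕ} (hr : 0 < r) (hr' : 0 < r') (A B : ZMod q)
    (f f' : Fin (r - 1) → ZMod q → ZMod q) (h h' : Fin (r' - 1) → ZMod q → ZMod q)
    (g : Fin r → ZMod q → ZMod q) (g' : Fin r' → ZMod q → ZMod q)
    (f₀ h₀ : ZMod q → ZMod q) (γ s s' : ZMod q) (X : Fin r → ZMod q) (X' : Fin r' → ZMod q) :
    ZMod q :=
  A * pathSum f f' X + ∑ α, g α (X α) + B * pathSum h h' X' + ∑ β, g' β (X' β) +
    γ * f₀ (X ⟨r - 1, by omega⟩) * h₀ (X' ⟨0, hr'⟩) +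
    A * (s * X ⟨r - 1, by omega⟩) + B * (s' * X' ⟨r' - 1, by omega⟩)

theorem exists_phase_update_sub_left {q r r' : ℕ} (hr : 0 < r) (hr' : 0 < r') (A B : ZMod q)
    (f f' : Fin (r - 1) → ZMod q → ZMod q) (h h' : Fin (r' - 1) → ZMod q → ZMod q)
    (g : Fin r → ZMod q → ZMod q) (g' : Fin r' → ZMod q → ZMod q)
    (f₀ h₀ : ZMod q → ZMod q) (γ s s' t t' : ZMod q) (k : Fin (r - 1)) {X Y : Fin r → ZMod q}
    (hXY : ∀ j : Fin r, (j : ℕ) ≤ k → X j = Y j) (X' Y' : Fin r' → ZMod q) :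
    ∃ C, ∀ u,
      phase hr hr' A B f f' h h' g g' f₀ h₀ γ s s' (Function.update X ⟨k, by omega⟩ u) X' -
        phase hr hr' A B f f' h h' g g' f₀ h₀ γ t t' (Function.update Y ⟨k, by omega⟩ u) Y' =
      A * (f k u * (f' k (X ⟨k + 1, by omega⟩) - f' k (Y ⟨k + 1, by omega⟩))) + C := by
  refine ⟨A * (pathTail f f' k X - pathTail f f' k Y) + (∑ α, g α (X α) - ∑ α, g α (Y α)) +
    (phase hr hr' A B f f' h h' g g' f₀ h₀ γ s s' X X' - A * pathSum f f' X - ∑ α, g α (X α)) -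
    (phase hr hr' A B f f' h h' g g' f₀ h₀ γ t t' Y Y' - A * pathSum f f' Y - ∑ α, g α (Y α)),
    fun u => ?_⟩
  have h1 := pathSum_update_sub f f' k hXY u
  have h2 := sum_update_sub g (hXY ⟨k, by omega⟩ le_rfl) u
  have h3 : (⟨r - 1, by omega⟩ : Fin r) ≠ ⟨k, by omega⟩ := by simp; omega
  unfold phase
  rw [Function.update_of_ne h3, Function.update_of_ne h3]
  linear_combination A * h1 + h2

theorem exists_phase_update_sub_right {q r r' : ℕ} (hr : 0 < r) (hr' : 0 < r') (A B : ZMod q)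
    (f f' : Fin (r - 1) → ZMod q → ZMod q) (h h' : Fin (r' - 1) → ZMod q → ZMod q)
    (g : Fin r → ZMod q → ZMod q) (g' : Fin r' → ZMod q → ZMod q)
    (f₀ h₀ : ZMod q → ZMod q) (γ s s' t t' : ZMod q) (k : Fin (r' - 1)) (X : Fin r → ZMod q)
    {X' Y' : Fin r' → ZMod q} (hXY : ∀ j : Fin r', (j : ℕ) ≤ k → X' j = Y' j) :
    ∃ C, ∀ u,
      phase hr hr' A B f f' h h' g g' f₀ h₀ γ s s' X (Function.update X' ⟨k, by omega⟩ u) -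
        phase hr hr' A B f f' h h' g g' f₀ h₀ γ t t' X (Function.update Y' ⟨k, by omega⟩ u) =
      B * (h k u * (h' k (X' ⟨k + 1, by omega⟩) - h' k (Y' ⟨k + 1, by omega⟩))) + C := by
  refine ⟨B * (pathTail h h' k X' - pathTail h h' k Y') +
    (∑ α, g' α (X' α) - ∑ α, g' α (Y' α)) +
    A * ((s - t) * X ⟨r - 1, by omega⟩) + B * (s' * X' ⟨r' - 1, by omega⟩) -
    B * (t' * Y' ⟨r' - 1, by omega⟩), fun u => ?_⟩
  have h1 := pathSum_update_sub h h' k hXY u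
  have h2 := sum_update_sub g' (hXY ⟨k, by omega⟩ le_rfl) u
  have h3 : (⟨r' - 1, by omega⟩ : Fin r') ≠ ⟨k, by omega⟩ := by simp; omega
  have h4 : Function.update X' ⟨k, by omega⟩ u ⟨0, hr'⟩ =
      Function.update Y' ⟨k, by omega⟩ u ⟨0, hr'⟩ := by
    by_cases hk : (⟨0, hr'⟩ : Fin r') = ⟨k, by omega⟩
    · rw [hk, Function.update_self, Function.update_self]
    · rw [Function.update_of_ne hk, Function.update_of_ne hk, hXY ⟨0, hr'⟩ (Nat.zero_le _)]
  unfold phase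
  rw [Function.update_of_ne h3, Function.update_of_ne h3, h4]
  linear_combination B * h1 + h2

/-- The pair `(X, Y)` coincides with `(X₀, Y₀)` wherever `X₀` and `Y₀` differ, and `X`, `Y` agree
elsewhere. -/
def SimilarPair {ι α : Type*} (X₀ Y₀ X Y : ι → α) : Prop :=
  ∀ i, (X₀ i = Y₀ i → X i = Y i) ∧ (X₀ i ≠ Y₀ i → X i = X₀ i ∧ Y i = Y₀ i)

/-- The linear functional `g ↦ ∑ i, (g_i(X_i) - g_i(Y_i)) - (g_i(X₀_i) - g_i(Y₀_i))`. -/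
def diffFunctional {ι : Type*} [Fintype ι] {q : ℕ} (X₀ Y₀ X Y : ι → ZMod q) :
    (ι → ZMod q → ZMod q) →+ ZMod q :=
  AddMonoidHom.mk' (fun g => ∑ i, ((g i (X i) - g i (Y i)) - (g i (X₀ i) - g i (Y₀ i)))) (by
    intro g g'
    rw [← Finset.sum_add_distrib]
    refine Finset.sum_congr rfl fun i _ => ?_
    simp only [Pi.add_apply]
    ring)

theorem diffFunctional_apply {ι : Type*} [Fintype ι] {q : ℕ} (X₀ Y₀ X Y : ι → ZMod q)
    (g : ι → ZMod q → ZMod q) : diffFunctional X₀ Y₀ X Y g =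
      ∑ i, ((g i (X i) - g i (Y i)) - (g i (X₀ i) - g i (Y₀ i))) := rfl

theorem diffFunctional_eq_zero_iff {ι : Type*} [Fintype ι] {q : ℕ} (hq : 2 < q)
    (X₀ Y₀ X Y : ι → ZMod q) :
    diffFunctional X₀ Y₀ X Y = 0 ↔ SimilarPair X₀ Y₀ X Y := by
  have : Fact (1 < q) := ⟨by omega⟩
  have : Fact (2 < q) := ⟨hq⟩
  have h11 : (-1 : ZMod q) ≠ 1 := ZMod.neg_one_ne_one
  constructor
  · intro h i
    have key : ∀ φ : ZMod q → ZMod q, (φ (X i) - φ (Y i)) - (φ (X₀ i) - φ (Y₀ i)) = 0 := by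
      intro φ
      have h1 := DFunLike.congr_fun h (fun j => if j = i then φ else 0)
      rw [diffFunctional_apply, Finset.sum_eq_single i] at h1
      · simpa using h1
      · intro j _ hj; simp [hj]
      · simp
    have hX := key (fun w => if w = X₀ i then 1 else 0)
    have hY := key (fun w => if w = Y₀ i then 1 else 0)
    have hX' := key (fun w => if w = X i then 1 else 0)
    constructor
    · intro h0
      by_contra hne
      rw [h0] at hX'
      simp [Ne.symm hne] at hX'
    · intro h0
      have hx : X i = X₀ i := by
        by_contra hne
        by_cases hy : Y i = X₀ i
        · simp [hne, hy, Ne.symm h0] at hX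
          exact h11 (by linear_combination hX)
        · simp [hne, hy, Ne.symm h0] at hX
      refine ⟨hx, ?_⟩
      by_contra hne
      simp [hx, h0, hne] at hY
  · intro h
    refine DFunLike.ext _ _ fun g => ?_
    rw [diffFunctional_apply]
    refine Finset.sum_eq_zero fun i _ => ?_
    by_cases h0 : X₀ i = Y₀ i
    · rw [(h i).1 h0, h0]; ring
    · rw [((h i).2 h0).1, ((h i).2 h0).2]; ring

theorem sum_similarPair_eq_zero {ι Z : Type*} [Fintype ι] {q : ℕ} [NeZero q] (hq : 2 < q)
    (S : Finset Z) (Q : Z → ZMod q) (X Y : Z → ι → ZMod q)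
    (h : ∀ g : ι → ZMod q → ZMod q,
      ∑ z ∈ S, ZMod.stdAddChar (Q z + ∑ i, (g i (X z i) - g i (Y z i))) = 0)
    (X₀ Y₀ : ι → ZMod q) :
    ∑ z ∈ S.filter (fun z => SimilarPair X₀ Y₀ (X z) (Y z)), ZMod.stdAddChar (Q z) = 0 := by
  have h1 : ∑ g : ι → ZMod q → ZMod q, ZMod.stdAddChar (-∑ i, (g i (X₀ i) - g i (Y₀ i))) *
      ∑ z ∈ S, ZMod.stdAddChar (Q z + ∑ i, (g i (X z i) - g i (Y z i))) = 0 := by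
    simp only [h, mul_zero, Finset.sum_const_zero]
  simp only [Finset.mul_sum] at h1
  rw [Finset.sum_comm] at h1
  have h2 : ∀ z, ∑ g : ι → ZMod q → ZMod q,
      ZMod.stdAddChar (-∑ i, (g i (X₀ i) - g i (Y₀ i))) *
        ZMod.stdAddChar (Q z + ∑ i, (g i (X z i) - g i (Y z i))) =
      (Fintype.card (ι → ZMod q → ZMod q) : ℂ) *
        if SimilarPair X₀ Y₀ (X z) (Y z) then ZMod.stdAddChar (Q z) else 0 := by
    intro z
    have h3 : ∀ g : ι → ZMod q → ZMod q,
        ZMod.stdAddChar (-∑ i, (g i (X₀ i) - g i (Y₀ i))) *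
          ZMod.stdAddChar (Q z + ∑ i, (g i (X z i) - g i (Y z i))) =
        ZMod.stdAddChar (Q z) *
          (ZMod.stdAddChar (N := q)).compAddMonoidHom (diffFunctional X₀ Y₀ (X z) (Y z)) g := by
      intro g
      rw [AddChar.compAddMonoidHom_apply, show diffFunctional X₀ Y₀ (X z) (Y z) g =
          (∑ i, (g i (X z i) - g i (Y z i))) - ∑ i, (g i (X₀ i) - g i (Y₀ i)) from
          Finset.sum_sub_distrib _ _,
        ← AddChar.map_add_eq_mul, ← AddChar.map_add_eq_mul]
      congr 1
      ring
    simp only [h3, ← Finset.mul_sum]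
    have h4 : (ZMod.stdAddChar (N := q)).compAddMonoidHom (diffFunctional X₀ Y₀ (X z) (Y z)) = 0 ↔
        SimilarPair X₀ Y₀ (X z) (Y z) := by
      rw [← diffFunctional_eq_zero_iff hq, AddChar.eq_zero_iff]
      constructor
      · intro h5
        refine DFunLike.ext _ _ fun g => ?_
        refine ZMod.injective_stdAddChar ?_
        rw [AddMonoidHom.zero_apply, AddChar.map_zero_eq_one, ← h5 g,
          AddChar.compAddMonoidHom_apply]
      · intro h5 g
        rw [AddChar.compAddMonoidHom_apply, h5, AddMonoidHom.zero_apply,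
          AddChar.map_zero_eq_one]
    rw [AddChar.sum_eq_ite]
    simp only [h4]
    split_ifs <;> ring
  simp only [h2, ← Finset.mul_sum] at h1
  rw [Finset.sum_filter]
  refine (mul_eq_zero.1 h1).resolve_left ?_
  exact_mod_cast Fintype.card_ne_zero

/-- The restricted digits of `x`. -/
def restr (p₁ p₂ : ℕ) {m₁ m₂ n₁ n₂ : ℕ} (J₁ : Fin n₁ → Fin m₁) (J₂ : Fin n₂ → Fin m₂) (x : ℕ) :
    (Fin n₁ → ℕ) × (Fin n₂ → ℕ) :=
  (fun i => mdig p₁ p₂ m₁ x (J₁ i), fun i => mdig p₁ p₂ m₁ x (m₁ + J₂ i))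

/-- The digits of `x` at the positions listed by `e`, as elements of `ℤ_{p₁p₂}`. -/
def digitVec (p₁ p₂ m₁ : ℕ) {r : ℕ} (e : Fin r → ℕ) (x : ℕ) : Fin r → ZMod (p₁ * p₂) :=
  fun i => mdigZ (p₁ * p₂) p₁ p₂ m₁ x (e i)

/-- The part of the exponent of `psi2r` that does not depend on the sequence index. -/
def codeExponent (p₁ p₂ m₁ m₂ n₁ n₂ : ℕ) (hr : 0 < m₁ - n₁) (hr' : 0 < m₂ - n₂)
    (J₁ : Fin n₁ → Fin m₁) (J₂ : Fin n₂ → Fin m₂)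
    (fi f'i : Fin (m₁ - n₁ - 1) → ZMod (p₁ * p₂) → ZMod (p₁ * p₂))
    (hj h'j : Fin (m₂ - n₂ - 1) → ZMod (p₁ * p₂) → ZMod (p₁ * p₂))
    (πc : ((Fin n₁ → ℕ) × (Fin n₂ → ℕ)) → Fin (m₁ - n₁) → Fin m₁)
    (π'c : ((Fin n₁ → ℕ) × (Fin n₂ → ℕ)) → Fin (m₂ - n₂) → Fin m₂)
    (gc : ((Fin n₁ → ℕ) × (Fin n₂ → ℕ)) → Fin (m₁ - n₁) →
      ZMod (p₁ * p₂) → ZMod (p₁ * p₂))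
    (g'c : ((Fin n₁ → ℕ) × (Fin n₂ → ℕ)) → Fin (m₂ - n₂) →
      ZMod (p₁ * p₂) → ZMod (p₁ * p₂))
    (fc hc : ((Fin n₁ → ℕ) × (Fin n₂ → ℕ)) → ZMod (p₁ * p₂) → ZMod (p₁ * p₂))
    (γc : ((Fin n₁ → ℕ) × (Fin n₂ → ℕ)) → ZMod (p₁ * p₂)) (t x : ℕ) : ZMod (p₁ * p₂) :=
  let c := restr p₁ p₂ J₁ J₂ x
  phase hr hr' ((p₁ * p₂ / p₁ : ℕ) : ZMod (p₁ * p₂)) ((p₁ * p₂ / p₂ : ℕ) : ZMod (p₁ * p₂))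
      fi f'i hj h'j (gc c) (g'c c) (fc c) (hc c) (γc c)
      (mdig p₁ p₂ (n₁ + 1) t n₁ : ZMod (p₁ * p₂))
      (mdig p₁ p₂ (n₁ + 1) t (n₁ + 1 + n₂) : ZMod (p₁ * p₂))
      (digitVec p₁ p₂ m₁ (fun i => (πc c i : ℕ)) x)
      (digitVec p₁ p₂ m₁ (fun i => m₁ + (π'c c i : ℕ)) x) +
    ((p₁ * p₂ / p₁ : ℕ) : ZMod (p₁ * p₂)) *
      (∑ v : Fin n₁, (mdig p₁ p₂ (n₁ + 1) t v : ZMod (p₁ * p₂)) * (c.1 v : ZMod (p₁ * p₂))) +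
    ((p₁ * p₂ / p₂ : ℕ) : ZMod (p₁ * p₂)) *
      (∑ v : Fin n₂, (mdig p₁ p₂ (n₁ + 1) t (n₁ + 1 + v) : ZMod (p₁ * p₂)) *
        (c.2 v : ZMod (p₁ * p₂)))

section

variable {p₁ p₂ m₁ m₂ n₁ n₂ : ℕ}
  {J₁ : Fin n₁ → Fin m₁} {J₂ : Fin n₂ → Fin m₂}
  {fi f'i : Fin (m₁ - n₁ - 1) → ZMod (p₁ * p₂) → ZMod (p₁ * p₂)}
  {hj h'j : Fin (m₂ - n₂ - 1) → ZMod (p₁ * p₂) → ZMod (p₁ * p₂)}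
  {πc : ((Fin n₁ → ℕ) × (Fin n₂ → ℕ)) → Fin (m₁ - n₁) → Fin m₁}
  {π'c : ((Fin n₁ → ℕ) × (Fin n₂ → ℕ)) → Fin (m₂ - n₂) → Fin m₂}
  {gc : ((Fin n₁ → ℕ) × (Fin n₂ → ℕ)) → Fin (m₁ - n₁) → ZMod (p₁ * p₂) → ZMod (p₁ * p₂)}
  {g'c : ((Fin n₁ → ℕ) × (Fin n₂ → ℕ)) → Fin (m₂ - n₂) → ZMod (p₁ * p₂) → ZMod (p₁ * p₂)}
  {fc hc : ((Fin n₁ → ℕ) × (Fin n₂ → ℕ)) → ZMod (p₁ * p₂) → ZMod (p₁ * p₂)}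
  {γc : ((Fin n₁ → ℕ) × (Fin n₂ → ℕ)) → ZMod (p₁ * p₂)}

theorem psi2r_eq_stdAddChar [NeZero p₁] [NeZero p₂] (hm₁ : 2 ≤ m₁) (hm₂ : 2 ≤ m₂)
    (hn₁ : n₁ ≤ m₁ - 1) (hn₂ : n₂ ≤ m₂ - 1) (hr : 0 < m₁ - n₁) (hr' : 0 < m₂ - n₂) (t : ℕ)
    (d : (Fin n₁ → Fin p₁) × Fin p₁ × (Fin n₂ → Fin p₂) × Fin p₂) (x : ℕ) :
    psi2r p₁ p₂ m₁ m₂ n₁ n₂ hm₁ hm₂ hn₁ hn₂ J₁ J₂ fi f'i hj h'j πc π'c gc g'c fc hc γc t d x =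
      ZMod.stdAddChar (codeExponent p₁ p₂ m₁ m₂ n₁ n₂ hr hr' J₁ J₂ fi f'i hj h'j πc π'c gc g'c
          fc hc γc t x +
        ((p₁ * p₂ / p₁ : ℕ) : ZMod (p₁ * p₂)) *
          (∑ v, ((d.1 v : ℕ) : ZMod (p₁ * p₂)) *
            ((restr p₁ p₂ J₁ J₂ x).1 v : ZMod (p₁ * p₂))) +
        ((p₁ * p₂ / p₁ : ℕ) : ZMod (p₁ * p₂)) * (((d.2.1 : ℕ) : ZMod (p₁ * p₂)) *
          (mdig p₁ p₂ m₁ x (πc (restr p₁ p₂ J₁ J₂ x) ⟨0, hr⟩) : ZMod (p₁ * p₂))) +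
        ((p₁ * p₂ / p₂ : ℕ) : ZMod (p₁ * p₂)) *
          (∑ v, ((d.2.2.1 v : ℕ) : ZMod (p₁ * p₂)) *
            ((restr p₁ p₂ J₁ J₂ x).2 v : ZMod (p₁ * p₂))) +
        ((p₁ * p₂ / p₂ : ℕ) : ZMod (p₁ * p₂)) * (((d.2.2.2 : ℕ) : ZMod (p₁ * p₂)) *
          (mdig p₁ p₂ m₁ x (m₁ + π'c (restr p₁ p₂ J₁ J₂ x) ⟨0, hr'⟩) : ZMod (p₁ * p₂)))) := by
  have hd : ∀ v, v < n₁ + 1 → t % p₁ ^ (n₁ + 1) / p₁ ^ v % p₁ = mdig p₁ p₂ (n₁ + 1) t v :=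
    fun v hv => (if_pos hv).symm
  have hd' : ∀ v, t / p₁ ^ (n₁ + 1) / p₂ ^ v % p₂ = mdig p₁ p₂ (n₁ + 1) t (n₁ + 1 + v) := by
    intro v
    rw [mdig, if_neg (by omega), Nat.add_sub_cancel_left]
  have h1 : ∀ v : Fin n₁, t % p₁ ^ (n₁ + 1) / p₁ ^ (v : ℕ) % p₁ =
      mdig p₁ p₂ (n₁ + 1) t v := fun v => hd v (by omega)
  simp only [psi2r]
  rw [xi_pow_val]
  simp only [h1, hd n₁ (Nat.lt_succ_self _), hd', add_mul, Finset.sum_add_distrib]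
  congr 1
  change _ + _ + _ = (_ + _ + _ + _ + _ + _ + _) + _ + _ + _ + _ + _ + _
  have hf : f2r p₁ p₂ m₁ m₂ n₁ n₂ hm₁ hm₂ hn₁ hn₂ J₁ J₂ fi f'i hj h'j πc π'c gc g'c fc hc γc x =
    _ + _ + _ + _ + _ := rfl
  rw [hf]
  simp only [pathSum, restr, digitVec, mdigZ, Fin.castLE, Fin.cast, Fin.succ]
  ring

/-- The pairs of positions at shift `τ` that survive summation over the sequence index. -/
noncomputable def survivingPairs (p₁ p₂ : ℕ) {m₁ m₂ n₁ n₂ : ℕ}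
    (hr : 0 < m₁ - n₁) (hr' : 0 < m₂ - n₂)
    (J₁ : Fin n₁ → Fin m₁) (J₂ : Fin n₂ → Fin m₂)
    (πc : ((Fin n₁ → ℕ) × (Fin n₂ → ℕ)) → Fin (m₁ - n₁) → Fin m₁)
    (π'c : ((Fin n₁ → ℕ) × (Fin n₂ → ℕ)) → Fin (m₂ - n₂) → Fin m₂) (τ : ℤ) : Finset (ℕ × ℕ) :=
  (shiftPairs (p₁ ^ m₁ * p₂ ^ m₂) τ).filter fun z =>
    restr p₁ p₂ J₁ J₂ z.1 = restr p₁ p₂ J₁ J₂ z.2 ∧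
    mdig p₁ p₂ m₁ z.1 (πc (restr p₁ p₂ J₁ J₂ z.1) ⟨0, hr⟩) =
      mdig p₁ p₂ m₁ z.2 (πc (restr p₁ p₂ J₁ J₂ z.2) ⟨0, hr⟩) ∧
    mdig p₁ p₂ m₁ z.1 (m₁ + π'c (restr p₁ p₂ J₁ J₂ z.1) ⟨0, hr'⟩) =
      mdig p₁ p₂ m₁ z.2 (m₁ + π'c (restr p₁ p₂ J₁ J₂ z.2) ⟨0, hr'⟩)

theorem codeACCF_psi2r [NeZero p₁] [NeZero p₂] (hm₁ : 2 ≤ m₁) (hm₂ : 2 ≤ m₂)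
    (hn₁ : n₁ ≤ m₁ - 1) (hn₂ : n₂ ≤ m₂ - 1) (hr : 0 < m₁ - n₁) (hr' : 0 < m₂ - n₂) (t t' : ℕ)
    (τ : ℤ) :
    codeACCF (p₁ ^ m₁ * p₂ ^ m₂)
      (psi2r p₁ p₂ m₁ m₂ n₁ n₂ hm₁ hm₂ hn₁ hn₂ J₁ J₂ fi f'i hj h'j πc π'c gc g'c fc hc γc t)
      (psi2r p₁ p₂ m₁ m₂ n₁ n₂ hm₁ hm₂ hn₁ hn₂ J₁ J₂ fi f'i hj h'j πc π'c gc g'c fc hc γc t') τ =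
    (p₁ ^ (n₁ + 1) * p₂ ^ (n₂ + 1) : ℕ) * ∑ z ∈ survivingPairs p₁ p₂ hr hr' J₁ J₂ πc π'c τ,
      ZMod.stdAddChar (
        codeExponent p₁ p₂ m₁ m₂ n₁ n₂ hr hr' J₁ J₂ fi f'i hj h'j πc π'c gc g'c fc hc γc t z.1 -
        codeExponent p₁ p₂ m₁ m₂ n₁ n₂ hr hr' J₁ J₂ fi f'i hj h'j πc π'c gc g'c fc hc γc t' z.2) := by
  have hp₁ : 0 < p₁ := Nat.pos_of_neZero p₁
  have hp₂ : 0 < p₂ := Nat.pos_of_neZero p₂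
  have hlt₁ : ∀ x j, j < m₁ → mdig p₁ p₂ m₁ x j < p₁ := fun x j hj => by
    simpa [radix, hj] using mdig_lt hp₁ hp₂ m₁ x j
  have hlt₂ : ∀ x j, mdig p₁ p₂ m₁ x (m₁ + j) < p₂ := fun x j => by
    simpa [radix] using mdig_lt hp₁ hp₂ m₁ x (m₁ + j)
  exact codeACCF_eq_sum_filter _ _ _ _ _ (restr p₁ p₂ J₁ J₂)
    (fun x => mdig p₁ p₂ m₁ x (πc (restr p₁ p₂ J₁ J₂ x) ⟨0, hr⟩))
    (fun x => mdig p₁ p₂ m₁ x (m₁ + π'c (restr p₁ p₂ J₁ J₂ x) ⟨0, hr'⟩))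
    (fun x v => hlt₁ _ _ (J₁ v).isLt) (fun x v => hlt₂ _ _) (fun x => hlt₁ _ _ (Fin.isLt _))
    (fun x => hlt₂ _ _)
    (psi2r_eq_stdAddChar hm₁ hm₂ hn₁ hn₂ hr hr' t)
    (psi2r_eq_stdAddChar hm₁ hm₂ hn₁ hn₂ hr hr' t') τ

end

theorem mem_shiftPairs {L : ℕ} {τ : ℤ} {z : ℕ × ℕ} :
    z ∈ shiftPairs L τ ↔ (z.1 < L ∧ z.2 < L) ∧ (z.2 : ℤ) - z.1 = τ := by
  simp [shiftPairs]

theorem setDigit_mem_shiftPairs {p₁ p₂ m₁ m₂ : ℕ} (hp₁ : 0 < p₁) (hp₂ : 0 < p₂) {τ : ℤ}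
    {z : ℕ × ℕ} (hz : z ∈ shiftPairs (p₁ ^ m₁ * p₂ ^ m₂) τ) {j u : ℕ}
    (hu : u < radix p₁ p₂ m₁ j) (hzj : mdig p₁ p₂ m₁ z.1 j = mdig p₁ p₂ m₁ z.2 j) :
    (setDigit p₁ p₂ m₁ m₂ z.1 j u, setDigit p₁ p₂ m₁ m₂ z.2 j u) ∈
      shiftPairs (p₁ ^ m₁ * p₂ ^ m₂) τ := by
  rw [mem_shiftPairs] at hz ⊢
  refine ⟨⟨(setDigit_spec hp₁ hp₂ _ hu).1, (setDigit_spec hp₁ hp₂ _ hu).1⟩, ?_⟩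
  rw [← hz.2]
  exact setDigit_sub_setDigit hz.1.1 hz.1.2 hzj u

theorem restr_setDigit {p₁ p₂ m₁ m₂ n₁ n₂ : ℕ} (hp₁ : 0 < p₁) (hp₂ : 0 < p₂)
    {J₁ : Fin n₁ → Fin m₁} {J₂ : Fin n₂ → Fin m₂} {j u : ℕ} (hu : u < radix p₁ p₂ m₁ j)
    (hj₁ : ∀ v, (J₁ v : ℕ) ≠ j) (hj₂ : ∀ v, m₁ + (J₂ v : ℕ) ≠ j) (x : ℕ) :
    restr p₁ p₂ J₁ J₂ (setDigit p₁ p₂ m₁ m₂ x j u) = restr p₁ p₂ J₁ J₂ x := by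
  have h := (setDigit_spec (m₂ := m₂) hp₁ hp₂ x hu).2
  refine Prod.ext (funext fun v => ?_) (funext fun v => ?_)
  · simp only [restr]
    rw [h _ (by omega), Function.update_of_ne (hj₁ v)]
  · simp only [restr]
    rw [h _ (by omega), Function.update_of_ne (hj₂ v)]

theorem digitVec_setDigit {p₁ p₂ m₁ m₂ r : ℕ} (hp₁ : 0 < p₁) (hp₂ : 0 < p₂) {e : Fin r → ℕ}
    (he : Function.Injective e) (hlt : ∀ i, e i < m₁ + m₂) {k : Fin r} {u : ℕ}
    (hu : u < radix p₁ p₂ m₁ (e k)) (x : ℕ) :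
    digitVec p₁ p₂ m₁ e (setDigit p₁ p₂ m₁ m₂ x (e k) u) =
      Function.update (digitVec p₁ p₂ m₁ e x) k (u : ZMod (p₁ * p₂)) := by
  funext i
  simp only [digitVec, mdigZ]
  rw [(setDigit_spec hp₁ hp₂ x hu).2 _ (hlt i)]
  rcases eq_or_ne i k with rfl | hi
  · simp
  · simp [hi, he.ne hi, digitVec, mdigZ]

theorem digitVec_setDigit_of_ne {p₁ p₂ m₁ m₂ r : ℕ} (hp₁ : 0 < p₁) (hp₂ : 0 < p₂)
    {e : Fin r → ℕ} (hlt : ∀ i, e i < m₁ + m₂) {j u : ℕ} (hj : ∀ i, e i ≠ j)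
    (hu : u < radix p₁ p₂ m₁ j) (x : ℕ) :
    digitVec p₁ p₂ m₁ e (setDigit p₁ p₂ m₁ m₂ x j u) = digitVec p₁ p₂ m₁ e x := by
  funext i
  simp only [digitVec, mdigZ]
  rw [(setDigit_spec hp₁ hp₂ x hu).2 _ (hlt i), Function.update_of_ne (hj i)]

theorem digitVec_apply_eq_iff {p₁ p₂ m₁ r : ℕ} (hp₁ : 0 < p₁) (hp₂ : 0 < p₂) (e : Fin r → ℕ)
    (x y : ℕ) (i : Fin r) : digitVec p₁ p₂ m₁ e x i = digitVec p₁ p₂ m₁ e y i ↔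
      mdig p₁ p₂ m₁ x (e i) = mdig p₁ p₂ m₁ y (e i) := by
  have h : radix p₁ p₂ m₁ (e i) ≤ p₁ * p₂ := by
    unfold radix
    split_ifs
    · exact Nat.le_mul_of_pos_right _ hp₂
    · exact Nat.le_mul_of_pos_left _ hp₁
  simp only [digitVec, mdigZ]
  rw [ZMod.natCast_eq_natCast_iff',
    Nat.mod_eq_of_lt ((mdig_lt hp₁ hp₂ m₁ x (e i)).trans_le h),
    Nat.mod_eq_of_lt ((mdig_lt hp₁ hp₂ m₁ y (e i)).trans_le h)]

/-- The positions of a block are exhausted by the free and the restricted ones. -/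
theorem exists_eq_or_exists_eq {m n : ℕ} (hn : n ≤ m) {π : Fin (m - n) → Fin m}
    {J : Fin n → Fin m} (hπ : Function.Injective π) (hJ : Function.Injective J)
    (h : ∀ i j, π i ≠ J j) (a : Fin m) : (∃ i, π i = a) ∨ ∃ j, J j = a := by
  have hb : Function.Bijective (Sum.elim π J) := by
    rw [Fintype.bijective_iff_injective_and_card]
    exact ⟨hπ.sumElim hJ h, by simp; omega⟩
  obtain ⟨i | j, hs⟩ := hb.2 a
  · exact Or.inl ⟨i, hs⟩
  · exact Or.inr ⟨j, hs⟩

theorem exists_injective_compl {m n : ℕ} {J : Fin n → Fin m}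
    (hJ : Function.Injective J) :
    ∃ π : Fin (m - n) → Fin m, Function.Injective π ∧ ∀ i j, π i ≠ J j := by
  have hc : Fintype.card (Fin (m - n)) = Fintype.card {a // a ∉ Set.range J} := by
    rw [Fintype.card_subtype_compl, Fintype.card_fin, Fintype.card_fin]
    congr 1
    exact (Fintype.card_fin n).symm.trans (Fintype.card_congr (Equiv.ofInjective J hJ))
  let e := Fintype.equivOfCardEq hc
  exact ⟨fun i => e i, Subtype.val_injective.comp e.injective,
    fun i j hij => (e i).2 ⟨j, hij.symm⟩⟩

/-- The pairs at shift `τ` with the same restricted digits as `w` whose digits agree exactly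
where those of `w` agree. -/
noncomputable def patternPairs (p₁ p₂ : ℕ) {m₁ m₂ n₁ n₂ : ℕ} (J₁ : Fin n₁ → Fin m₁)
    (J₂ : Fin n₂ → Fin m₂) (τ : ℤ) (w : ℕ × ℕ) : Finset (ℕ × ℕ) :=
  (shiftPairs (p₁ ^ m₁ * p₂ ^ m₂) τ).filter fun z =>
    restr p₁ p₂ J₁ J₂ z.1 = restr p₁ p₂ J₁ J₂ w.1 ∧
    restr p₁ p₂ J₁ J₂ z.2 = restr p₁ p₂ J₁ J₂ w.1 ∧
    ∀ j < m₁ + m₂, (mdig p₁ p₂ m₁ z.1 j = mdig p₁ p₂ m₁ z.2 j ↔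
      mdig p₁ p₂ m₁ w.1 j = mdig p₁ p₂ m₁ w.2 j)

theorem sum_survivingPairs_eq_zero {p₁ p₂ m₁ m₂ n₁ n₂ : ℕ} {hr : 0 < m₁ - n₁}
    {hr' : 0 < m₂ - n₂} {J₁ : Fin n₁ → Fin m₁} {J₂ : Fin n₂ → Fin m₂}
    {πc : ((Fin n₁ → ℕ) × (Fin n₂ → ℕ)) → Fin (m₁ - n₁) → Fin m₁}
    {π'c : ((Fin n₁ → ℕ) × (Fin n₂ → ℕ)) → Fin (m₂ - n₂) → Fin m₂} {τ : ℤ} {F : ℕ × ℕ → ℂ}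
    (h : ∀ w ∈ survivingPairs p₁ p₂ hr hr' J₁ J₂ πc π'c τ,
      ∑ z ∈ patternPairs p₁ p₂ J₁ J₂ τ w, F z = 0) :
    ∑ z ∈ survivingPairs p₁ p₂ hr hr' J₁ J₂ πc π'c τ, F z = 0 := by
  let key : ℕ × ℕ → ((Fin n₁ → ℕ) × (Fin n₂ → ℕ)) × (Fin (m₁ + m₂) → Prop) := fun z =>
    (restr p₁ p₂ J₁ J₂ z.1, fun j => mdig p₁ p₂ m₁ z.1 j = mdig p₁ p₂ m₁ z.2 j)
  have h1 := Finset.sum_fiberwise_of_maps_to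
    (s := survivingPairs p₁ p₂ hr hr' J₁ J₂ πc π'c τ)
    (t := (survivingPairs p₁ p₂ hr hr' J₁ J₂ πc π'c τ).image key) (g := key)
    (fun z hz => Finset.mem_image_of_mem _ hz) F
  rw [← h1]
  refine Finset.sum_eq_zero fun y hy => ?_
  obtain ⟨w, hw, rfl⟩ := Finset.mem_image.1 hy
  rw [← h w hw]
  refine Finset.sum_congr ?_ fun _ _ => rfl
  ext z
  simp only [survivingPairs, patternPairs, Finset.mem_filter, key, Prod.mk.injEq,
    funext_iff (f := fun j : Fin (m₁ + m₂) => mdig p₁ p₂ m₁ z.1 j = mdig p₁ p₂ m₁ z.2 j)] at hw ⊢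
  constructor
  · rintro ⟨⟨hz, hz1, hz2, hz3⟩, hz4, hz5⟩
    exact ⟨hz, hz4, hz1.symm.trans hz4, fun j hj => iff_of_eq (hz5 ⟨j, hj⟩)⟩
  · rintro ⟨hz, hz1, hz2, hz3⟩
    refine ⟨⟨hz, hz1.trans hz2.symm, ?_, ?_⟩, hz1, fun j => propext (hz3 j j.2)⟩
    · rw [hz1, hz2, hz3 _ (by omega)]
      have := hw.2.2.1
      rwa [← hw.2.1] at this
    · rw [hz1, hz2, hz3 _ (by omega)]
      have := hw.2.2.2
      rwa [← hw.2.1] at this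

theorem sum_eq_zero_of_sum_setDigit {p₁ p₂ m₁ m₂ : ℕ} (hp₁ : 0 < p₁) (hp₂ : 0 < p₂) {j : ℕ}
    (hj : j < m₁ + m₂) {τ : ℤ} {S : Finset (ℕ × ℕ)}
    (hsub : S ⊆ shiftPairs (p₁ ^ m₁ * p₂ ^ m₂) τ) (F : ℕ → ℕ → ℂ)
    (heq : ∀ z ∈ S, mdig p₁ p₂ m₁ z.1 j = mdig p₁ p₂ m₁ z.2 j)
    (hS : ∀ z ∈ S, ∀ u < radix p₁ p₂ m₁ j,
      (setDigit p₁ p₂ m₁ m₂ z.1 j u, setDigit p₁ p₂ m₁ m₂ z.2 j u) ∈ S)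
    (hF : ∀ z ∈ S, ∑ u ∈ Finset.range (radix p₁ p₂ m₁ j),
      F (setDigit p₁ p₂ m₁ m₂ z.1 j u) (setDigit p₁ p₂ m₁ m₂ z.2 j u) = 0) :
    ∑ z ∈ S, F z.1 z.2 = 0 := by
  have h := sum_sum_setDigit hp₁ hp₂ hj S F (fun z hz => (mem_shiftPairs.1 (hsub hz)).1) heq hS
  rw [Finset.sum_eq_zero hF] at h
  refine (mul_eq_zero.1 h.symm).resolve_left ?_
  have : radix p₁ p₂ m₁ j ≠ 0 := by
    unfold radix
    split_ifs <;> omega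
  exact_mod_cast this

theorem sum_patternPairs_eq_zero {p₁ p₂ m₁ m₂ n₁ n₂ : ℕ} (hp₁ : 0 < p₁) (hp₂ : 0 < p₂)
    {J₁ : Fin n₁ → Fin m₁} {J₂ : Fin n₂ → Fin m₂} {τ : ℤ} {w : ℕ × ℕ} {j : ℕ}
    (hj : j < m₁ + m₂) (hj₁ : ∀ v, (J₁ v : ℕ) ≠ j) (hj₂ : ∀ v, m₁ + (J₂ v : ℕ) ≠ j)
    (hw : mdig p₁ p₂ m₁ w.1 j = mdig p₁ p₂ m₁ w.2 j) (F : ℕ → ℕ → ℂ)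
    (hF : ∀ z ∈ patternPairs p₁ p₂ J₁ J₂ τ w, ∑ u ∈ Finset.range (radix p₁ p₂ m₁ j),
      F (setDigit p₁ p₂ m₁ m₂ z.1 j u) (setDigit p₁ p₂ m₁ m₂ z.2 j u) = 0) :
    ∑ z ∈ patternPairs p₁ p₂ J₁ J₂ τ w, F z.1 z.2 = 0 := by
  have heq : ∀ z ∈ patternPairs p₁ p₂ J₁ J₂ τ w,
      mdig p₁ p₂ m₁ z.1 j = mdig p₁ p₂ m₁ z.2 j := fun z hz =>
    ((Finset.mem_filter.1 hz).2.2.2 j hj).2 hw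
  refine sum_eq_zero_of_sum_setDigit hp₁ hp₂ hj (Finset.filter_subset _ _) F heq ?_ hF
  intro z hz u hu
  have hzj := heq z hz
  obtain ⟨hz0, hz1, hz2, hz3⟩ := Finset.mem_filter.1 hz
  refine Finset.mem_filter.2 ⟨setDigit_mem_shiftPairs hp₁ hp₂ hz0 hu hzj,
    (restr_setDigit hp₁ hp₂ hu hj₁ hj₂ _).trans hz1,
    (restr_setDigit hp₁ hp₂ hu hj₁ hj₂ _).trans hz2, fun i hi => ?_⟩
  rw [(setDigit_spec hp₁ hp₂ z.1 hu).2 i hi, (setDigit_spec hp₁ hp₂ z.2 hu).2 i hi]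
  rcases eq_or_ne i j with rfl | hij
  · simp [hw]
  · simp [hij, hz3 i hi]

theorem castHom_sub_ne_zero {q p : ℕ} [NeZero q] (h : p ∣ q) {φ : ZMod q → ZMod q}
    (hφ : PermutesMod q p φ) {a b : ℕ} (ha : a < p) (hb : b < p) (hab : a ≠ b) :
    ZMod.castHom h (ZMod p) (φ (a : ZMod q) - φ (b : ZMod q)) ≠ 0 := by
  rw [permutesMod_iff h] at hφ
  rw [map_sub, sub_ne_zero]
  intro h0
  exact hab (congrArg Fin.val (hφ.1 (a₁ := ⟨a, ha⟩) (a₂ := ⟨b, hb⟩) h0))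

theorem sum_stdAddChar_eq_zero_of_permutesMod {q p : ℕ} [NeZero q] [NeZero p] (h : p ∣ q)
    {φ : ZMod q → ZMod q} (hφ : PermutesMod q p φ) {c C : ZMod q}
    (hc : ZMod.castHom h (ZMod p) c ≠ 0) {Q : ℕ → ZMod q}
    (hQ : ∀ u < p, Q u = ((q / p : ℕ) : ZMod q) * (φ (u : ZMod q) * c) + C) :
    ∑ u ∈ Finset.range p, ZMod.stdAddChar (Q u) = 0 := by
  have h1 : ∀ u ∈ Finset.range p, ZMod.stdAddChar (Q u) =
      ZMod.stdAddChar (((q / p : ℕ) : ZMod q) * (φ (u : ZMod q) * c)) * ZMod.stdAddChar C :=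
    fun u hu => by rw [hQ u (Finset.mem_range.1 hu), AddChar.map_add_eq_mul]
  rw [Finset.sum_congr rfl h1, ← Finset.sum_mul, sum_stdAddChar_of_permutesMod h hφ, if_neg hc,
    zero_mul]

section

variable {p₁ p₂ m₁ m₂ n₁ n₂ : ℕ} {hr : 0 < m₁ - n₁} {hr' : 0 < m₂ - n₂}
  {J₁ : Fin n₁ → Fin m₁} {J₂ : Fin n₂ → Fin m₂}
  {fi f'i : Fin (m₁ - n₁ - 1) → ZMod (p₁ * p₂) → ZMod (p₁ * p₂)}
  {hj h'j : Fin (m₂ - n₂ - 1) → ZMod (p₁ * p₂) → ZMod (p₁ * p₂)}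
  {πc : ((Fin n₁ → ℕ) × (Fin n₂ → ℕ)) → Fin (m₁ - n₁) → Fin m₁}
  {π'c : ((Fin n₁ → ℕ) × (Fin n₂ → ℕ)) → Fin (m₂ - n₂) → Fin m₂}
  {gc : ((Fin n₁ → ℕ) × (Fin n₂ → ℕ)) → Fin (m₁ - n₁) → ZMod (p₁ * p₂) → ZMod (p₁ * p₂)}
  {g'c : ((Fin n₁ → ℕ) × (Fin n₂ → ℕ)) → Fin (m₂ - n₂) → ZMod (p₁ * p₂) → ZMod (p₁ * p₂)}
  {fc hc : ((Fin n₁ → ℕ) × (Fin n₂ → ℕ)) → ZMod (p₁ * p₂) → ZMod (p₁ * p₂)}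
  {γc : ((Fin n₁ → ℕ) × (Fin n₂ → ℕ)) → ZMod (p₁ * p₂)}

/-- Summation over the digit preceding the first difference in the first block. -/
theorem sum_patternPairs_eq_zero_of_left [NeZero p₁] [NeZero p₂]
    (hfi : ∀ i, PermutesMod (p₁ * p₂) p₁ (fi i) ∧ PermutesMod (p₁ * p₂) p₁ (f'i i))
    (hπ : ∀ c, Function.Injective (πc c) ∧ ∀ i j, πc c i ≠ J₁ j) {τ : ℤ} {w : ℕ × ℕ}
    (k : Fin (m₁ - n₁ - 1))
    (hk : ∀ i : Fin (m₁ - n₁), (i : ℕ) ≤ k →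
      mdig p₁ p₂ m₁ w.1 (πc (restr p₁ p₂ J₁ J₂ w.1) i) =
        mdig p₁ p₂ m₁ w.2 (πc (restr p₁ p₂ J₁ J₂ w.1) i))
    (hne : mdig p₁ p₂ m₁ w.1 (πc (restr p₁ p₂ J₁ J₂ w.1) ⟨k + 1, by omega⟩) ≠
      mdig p₁ p₂ m₁ w.2 (πc (restr p₁ p₂ J₁ J₂ w.1) ⟨k + 1, by omega⟩)) (t t' : ℕ) :
    ∑ z ∈ patternPairs p₁ p₂ J₁ J₂ τ w, ZMod.stdAddChar (
      codeExponent p₁ p₂ m₁ m₂ n₁ n₂ hr hr' J₁ J₂ fi f'i hj h'j πc π'c gc g'c fc hc γc t z.1 -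
      codeExponent p₁ p₂ m₁ m₂ n₁ n₂ hr hr' J₁ J₂ fi f'i hj h'j πc π'c gc g'c fc hc γc t' z.2) =
      0 := by
  have hp₁ : 0 < p₁ := Nat.pos_of_neZero p₁
  have hp₂ : 0 < p₂ := Nat.pos_of_neZero p₂
  set c := restr p₁ p₂ J₁ J₂ w.1
  have hrad : ∀ i, radix p₁ p₂ m₁ (πc c i) = p₁ := fun i => if_pos (πc c i).isLt
  have hJ₁ : ∀ i v, (J₁ v : ℕ) ≠ πc c i := fun i v h => (hπ c).2 i v (Fin.ext h.symm)
  have hJ₂ : ∀ i v, m₁ + (J₂ v : ℕ) ≠ πc c i := fun i v => by omega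
  refine sum_patternPairs_eq_zero hp₁ hp₂ (j := πc c ⟨k, by omega⟩) (by omega) (hJ₁ _) (hJ₂ _)
    (hk _ le_rfl)
    (fun x y => ZMod.stdAddChar (
      codeExponent p₁ p₂ m₁ m₂ n₁ n₂ hr hr' J₁ J₂ fi f'i hj h'j πc π'c gc g'c fc hc γc t x -
      codeExponent p₁ p₂ m₁ m₂ n₁ n₂ hr hr' J₁ J₂ fi f'i hj h'j πc π'c gc g'c fc hc γc t' y)) ?_
  intro z hz
  obtain ⟨hz0, hz1, hz2, hz3⟩ := Finset.mem_filter.1 hz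
  set e : Fin (m₁ - n₁) → ℕ := fun i => (πc c i : ℕ)
  set e' : Fin (m₂ - n₂) → ℕ := fun i => m₁ + (π'c c i : ℕ)
  have he : Function.Injective e := Fin.val_injective.comp (hπ c).1
  have helt : ∀ i, e i < m₁ + m₂ := fun i => by simp only [e]; omega
  have helt' : ∀ i, e' i < m₁ + m₂ := fun i => by simp only [e']; omega
  have hee' : ∀ i, e' i ≠ e ⟨k, by omega⟩ := fun i => by simp only [e, e']; omega
  obtain ⟨C, hC⟩ := exists_phase_update_sub_left hr hr' ((p₁ * p₂ / p₁ : ℕ) : ZMod (p₁ * p₂))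
    ((p₁ * p₂ / p₂ : ℕ) : ZMod (p₁ * p₂)) fi f'i hj h'j (gc c) (g'c c) (fc c) (hc c) (γc c)
    (mdig p₁ p₂ (n₁ + 1) t n₁ : ZMod (p₁ * p₂))
    (mdig p₁ p₂ (n₁ + 1) t (n₁ + 1 + n₂) : ZMod (p₁ * p₂))
    (mdig p₁ p₂ (n₁ + 1) t' n₁ : ZMod (p₁ * p₂))
    (mdig p₁ p₂ (n₁ + 1) t' (n₁ + 1 + n₂) : ZMod (p₁ * p₂)) k
    (X := digitVec p₁ p₂ m₁ e z.1) (Y := digitVec p₁ p₂ m₁ e z.2)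
    (fun i hi => (digitVec_apply_eq_iff hp₁ hp₂ e _ _ i).2 ((hz3 _ (helt i)).2 (hk i hi)))
    (digitVec p₁ p₂ m₁ e' z.1) (digitVec p₁ p₂ m₁ e' z.2)
  have hκ : ZMod.castHom (dvd_mul_right p₁ p₂) (ZMod p₁)
      (f'i k (digitVec p₁ p₂ m₁ e z.1 ⟨k + 1, by omega⟩) -
        f'i k (digitVec p₁ p₂ m₁ e z.2 ⟨k + 1, by omega⟩)) ≠ 0 :=
    castHom_sub_ne_zero (dvd_mul_right p₁ p₂) (hfi k).2
    (a := mdig p₁ p₂ m₁ z.1 (e ⟨k + 1, by omega⟩)) (b := mdig p₁ p₂ m₁ z.2 (e ⟨k + 1, by omega⟩))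
    (hrad ⟨k + 1, by omega⟩ ▸ mdig_lt hp₁ hp₂ m₁ z.1 _)
    (hrad ⟨k + 1, by omega⟩ ▸ mdig_lt hp₁ hp₂ m₁ z.2 _)
    (fun h => hne ((hz3 _ (helt _)).1 h))
  rw [hrad]
  refine sum_stdAddChar_eq_zero_of_permutesMod (dvd_mul_right p₁ p₂) (hfi k).1 hκ
    (C := C + (((p₁ * p₂ / p₁ : ℕ) : ZMod (p₁ * p₂)) *
      (∑ v : Fin n₁, (mdig p₁ p₂ (n₁ + 1) t v : ZMod (p₁ * p₂)) * (c.1 v : ZMod (p₁ * p₂))) +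
    ((p₁ * p₂ / p₂ : ℕ) : ZMod (p₁ * p₂)) *
      (∑ v : Fin n₂, (mdig p₁ p₂ (n₁ + 1) t (n₁ + 1 + v) : ZMod (p₁ * p₂)) *
        (c.2 v : ZMod (p₁ * p₂)))) - (((p₁ * p₂ / p₁ : ℕ) : ZMod (p₁ * p₂)) *
      (∑ v : Fin n₁, (mdig p₁ p₂ (n₁ + 1) t' v : ZMod (p₁ * p₂)) * (c.1 v : ZMod (p₁ * p₂))) +
    ((p₁ * p₂ / p₂ : ℕ) : ZMod (p₁ * p₂)) *
      (∑ v : Fin n₂, (mdig p₁ p₂ (n₁ + 1) t' (n₁ + 1 + v) : ZMod (p₁ * p₂)) *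
        (c.2 v : ZMod (p₁ * p₂))))) ?_
  intro u hu
  have hu' : u < radix p₁ p₂ m₁ (e ⟨k, by omega⟩) := by rw [hrad]; exact hu
  have hx := restr_setDigit (m₂ := m₂) hp₁ hp₂ hu' (hJ₁ _) (hJ₂ _) z.1
  have hy := restr_setDigit (m₂ := m₂) hp₁ hp₂ hu' (hJ₁ _) (hJ₂ _) z.2
  simp only [codeExponent]
  rw [hx, hy, hz1, hz2, digitVec_setDigit hp₁ hp₂ he helt hu',
    digitVec_setDigit hp₁ hp₂ he helt hu', digitVec_setDigit_of_ne hp₁ hp₂ helt' hee' hu',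
    digitVec_setDigit_of_ne hp₁ hp₂ helt' hee' hu']
  linear_combination hC u

/-- Summation over the digit preceding the first difference in the second block. -/
theorem sum_patternPairs_eq_zero_of_right [NeZero p₁] [NeZero p₂]
    (hhj : ∀ j, PermutesMod (p₁ * p₂) p₂ (hj j) ∧ PermutesMod (p₁ * p₂) p₂ (h'j j))
    (hπ' : ∀ c, Function.Injective (π'c c) ∧ ∀ i j, π'c c i ≠ J₂ j) {τ : ℤ} {w : ℕ × ℕ}
    (heq : ∀ i : Fin (m₁ - n₁), mdig p₁ p₂ m₁ w.1 (πc (restr p₁ p₂ J₁ J₂ w.1) i) =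
        mdig p₁ p₂ m₁ w.2 (πc (restr p₁ p₂ J₁ J₂ w.1) i))
    (k : Fin (m₂ - n₂ - 1))
    (hk : ∀ i : Fin (m₂ - n₂), (i : ℕ) ≤ k →
      mdig p₁ p₂ m₁ w.1 (m₁ + π'c (restr p₁ p₂ J₁ J₂ w.1) i) =
        mdig p₁ p₂ m₁ w.2 (m₁ + π'c (restr p₁ p₂ J₁ J₂ w.1) i))
    (hne : mdig p₁ p₂ m₁ w.1 (m₁ + π'c (restr p₁ p₂ J₁ J₂ w.1) ⟨k + 1, by omega⟩) ≠
      mdig p₁ p₂ m₁ w.2 (m₁ + π'c (restr p₁ p₂ J₁ J₂ w.1) ⟨k + 1, by omega⟩)) (t t' : ℕ) :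
    ∑ z ∈ patternPairs p₁ p₂ J₁ J₂ τ w, ZMod.stdAddChar (
      codeExponent p₁ p₂ m₁ m₂ n₁ n₂ hr hr' J₁ J₂ fi f'i hj h'j πc π'c gc g'c fc hc γc t z.1 -
      codeExponent p₁ p₂ m₁ m₂ n₁ n₂ hr hr' J₁ J₂ fi f'i hj h'j πc π'c gc g'c fc hc γc t' z.2) =
      0 := by
  have hp₁ : 0 < p₁ := Nat.pos_of_neZero p₁
  have hp₂ : 0 < p₂ := Nat.pos_of_neZero p₂
  set c := restr p₁ p₂ J₁ J₂ w.1
  have hrad : ∀ i, radix p₁ p₂ m₁ (m₁ + π'c c i) = p₂ := fun i => if_neg (by omega)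
  have hJ₁ : ∀ i v, (J₁ v : ℕ) ≠ m₁ + π'c c i := fun i v => by omega
  have hJ₂ : ∀ i v, m₁ + (J₂ v : ℕ) ≠ m₁ + π'c c i :=
    fun i v h => (hπ' c).2 i v (Fin.ext (Nat.add_left_cancel h).symm)
  refine sum_patternPairs_eq_zero hp₁ hp₂ (j := m₁ + π'c c ⟨k, by omega⟩) (by omega) (hJ₁ _)
    (hJ₂ _) (hk _ le_rfl)
    (fun x y => ZMod.stdAddChar (
      codeExponent p₁ p₂ m₁ m₂ n₁ n₂ hr hr' J₁ J₂ fi f'i hj h'j πc π'c gc g'c fc hc γc t x -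
      codeExponent p₁ p₂ m₁ m₂ n₁ n₂ hr hr' J₁ J₂ fi f'i hj h'j πc π'c gc g'c fc hc γc t' y)) ?_
  intro z hz
  obtain ⟨hz0, hz1, hz2, hz3⟩ := Finset.mem_filter.1 hz
  set e : Fin (m₁ - n₁) → ℕ := fun i => (πc c i : ℕ)
  set e' : Fin (m₂ - n₂) → ℕ := fun i => m₁ + (π'c c i : ℕ)
  have he : Function.Injective e' :=
    (add_right_injective m₁).comp (Fin.val_injective.comp (hπ' c).1)
  have helt : ∀ i, e i < m₁ + m₂ := fun i => by simp only [e]; omega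
  have helt' : ∀ i, e' i < m₁ + m₂ := fun i => by simp only [e']; omega
  have hee' : ∀ i, e i ≠ e' ⟨k, by omega⟩ := fun i => by simp only [e, e']; omega
  have hXY : digitVec p₁ p₂ m₁ e z.1 = digitVec p₁ p₂ m₁ e z.2 := funext fun i =>
    (digitVec_apply_eq_iff hp₁ hp₂ e _ _ i).2 ((hz3 _ (helt i)).2 (heq i))
  obtain ⟨C, hC⟩ := exists_phase_update_sub_right hr hr' ((p₁ * p₂ / p₁ : ℕ) : ZMod (p₁ * p₂))
    ((p₁ * p₂ / p₂ : ℕ) : ZMod (p₁ * p₂)) fi f'i hj h'j (gc c) (g'c c) (fc c) (hc c) (γc c)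
    (mdig p₁ p₂ (n₁ + 1) t n₁ : ZMod (p₁ * p₂))
    (mdig p₁ p₂ (n₁ + 1) t (n₁ + 1 + n₂) : ZMod (p₁ * p₂))
    (mdig p₁ p₂ (n₁ + 1) t' n₁ : ZMod (p₁ * p₂))
    (mdig p₁ p₂ (n₁ + 1) t' (n₁ + 1 + n₂) : ZMod (p₁ * p₂)) k
    (digitVec p₁ p₂ m₁ e z.1)
    (X' := digitVec p₁ p₂ m₁ e' z.1) (Y' := digitVec p₁ p₂ m₁ e' z.2)
    (fun i hi => (digitVec_apply_eq_iff hp₁ hp₂ e' _ _ i).2 ((hz3 _ (helt' i)).2 (hk i hi)))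
  have hκ : ZMod.castHom (dvd_mul_left p₂ p₁) (ZMod p₂)
      (h'j k (digitVec p₁ p₂ m₁ e' z.1 ⟨k + 1, by omega⟩) -
        h'j k (digitVec p₁ p₂ m₁ e' z.2 ⟨k + 1, by omega⟩)) ≠ 0 :=
    castHom_sub_ne_zero (dvd_mul_left p₂ p₁) (hhj k).2
    (a := mdig p₁ p₂ m₁ z.1 (e' ⟨k + 1, by omega⟩))
    (b := mdig p₁ p₂ m₁ z.2 (e' ⟨k + 1, by omega⟩))
    (hrad ⟨k + 1, by omega⟩ ▸ mdig_lt hp₁ hp₂ m₁ z.1 _)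
    (hrad ⟨k + 1, by omega⟩ ▸ mdig_lt hp₁ hp₂ m₁ z.2 _)
    (fun h => hne ((hz3 _ (helt' _)).1 h))
  rw [hrad]
  refine sum_stdAddChar_eq_zero_of_permutesMod (dvd_mul_left p₂ p₁) (hhj k).1 hκ
    (C := C + (((p₁ * p₂ / p₁ : ℕ) : ZMod (p₁ * p₂)) *
      (∑ v : Fin n₁, (mdig p₁ p₂ (n₁ + 1) t v : ZMod (p₁ * p₂)) * (c.1 v : ZMod (p₁ * p₂))) +
    ((p₁ * p₂ / p₂ : ℕ) : ZMod (p₁ * p₂)) *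
      (∑ v : Fin n₂, (mdig p₁ p₂ (n₁ + 1) t (n₁ + 1 + v) : ZMod (p₁ * p₂)) *
        (c.2 v : ZMod (p₁ * p₂)))) - (((p₁ * p₂ / p₁ : ℕ) : ZMod (p₁ * p₂)) *
      (∑ v : Fin n₁, (mdig p₁ p₂ (n₁ + 1) t' v : ZMod (p₁ * p₂)) * (c.1 v : ZMod (p₁ * p₂))) +
    ((p₁ * p₂ / p₂ : ℕ) : ZMod (p₁ * p₂)) *
      (∑ v : Fin n₂, (mdig p₁ p₂ (n₁ + 1) t' (n₁ + 1 + v) : ZMod (p₁ * p₂)) *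
        (c.2 v : ZMod (p₁ * p₂))))) ?_
  intro u hu
  have hu' : u < radix p₁ p₂ m₁ (e' ⟨k, by omega⟩) := by rw [hrad]; exact hu
  have hx := restr_setDigit (m₂ := m₂) hp₁ hp₂ hu' (hJ₁ _) (hJ₂ _) z.1
  have hy := restr_setDigit (m₂ := m₂) hp₁ hp₂ hu' (hJ₁ _) (hJ₂ _) z.2
  simp only [codeExponent]
  rw [hx, hy, hz1, hz2, digitVec_setDigit hp₁ hp₂ he helt' hu',
    digitVec_setDigit hp₁ hp₂ he helt' hu', digitVec_setDigit_of_ne hp₁ hp₂ helt hee' hu',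
    digitVec_setDigit_of_ne hp₁ hp₂ helt hee' hu', ← hXY]
  linear_combination hC u

end

theorem exists_first_of_not_zero {r : ℕ} (hr : 0 < r) {P : Fin r → Prop} (h0 : ¬P ⟨0, hr⟩)
    (h : ∃ i, P i) : ∃ k : Fin (r - 1), (∀ i : Fin r, (i : ℕ) ≤ k → ¬P i) ∧
      P ⟨k + 1, by omega⟩ := by
  have hex : ∃ a, ∃ ha : a < r, P ⟨a, ha⟩ := by
    obtain ⟨i, hi⟩ := h
    exact ⟨i, i.isLt, hi⟩
  obtain ⟨ha, hPa⟩ := Nat.find_spec hex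
  have hpos : Nat.find hex ≠ 0 := by
    intro h1
    refine h0 ?_
    simpa only [h1] using hPa
  refine ⟨⟨Nat.find hex - 1, by omega⟩, fun i hi hPi => ?_, ?_⟩
  · have h2 := Nat.find_min' hex ⟨i.isLt, hPi⟩
    simp only at hi
    omega
  · have h3 : Nat.find hex - 1 + 1 = Nat.find hex := by omega
    simpa only [h3] using hPa

theorem sum_mul_update {R : Type*} [CommRing R] {n : ℕ} (a b : Fin n → R) (k : Fin n) (u : R) :
    ∑ v, a v * Function.update b k u v = a k * u + (∑ v, a v * b v - a k * b k) := by
  have h : ∀ v, a v * Function.update b k u v =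
      a v * b v + if v = k then a k * u - a k * b k else 0 := by
    intro v
    rcases eq_or_ne v k with rfl | hv
    · simp
    · simp [hv]
  simp only [h, Finset.sum_add_distrib, Finset.sum_ite_eq', Finset.mem_univ, if_true]
  ring

theorem fst_eq_snd_of_mem_shiftPairs_zero {L : ℕ} {z : ℕ × ℕ} (hz : z ∈ shiftPairs L 0) :
    z.1 = z.2 := by
  have := (mem_shiftPairs.1 hz).2
  omega

theorem card_shiftPairs_zero (L : ℕ) : (shiftPairs L 0).card = L := by
  have h : shiftPairs L 0 = (Finset.range L).image fun x => (x, x) := by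
    ext ⟨x, y⟩
    simp only [mem_shiftPairs, Finset.mem_image, Finset.mem_range, Prod.mk.injEq]
    constructor
    · rintro ⟨⟨hx, hy⟩, hxy⟩
      exact ⟨x, hx, rfl, by omega⟩
    · rintro ⟨a, ha, rfl, rfl⟩
      simp [ha]
  rw [h, Finset.card_image_of_injective _ fun a b hab => congrArg Prod.fst hab,
    Finset.card_range]

section

variable {p₁ p₂ m₁ m₂ n₁ n₂ : ℕ} {hr : 0 < m₁ - n₁} {hr' : 0 < m₂ - n₂}
  {J₁ : Fin n₁ → Fin m₁} {J₂ : Fin n₂ → Fin m₂}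
  {fi f'i : Fin (m₁ - n₁ - 1) → ZMod (p₁ * p₂) → ZMod (p₁ * p₂)}
  {hj h'j : Fin (m₂ - n₂ - 1) → ZMod (p₁ * p₂) → ZMod (p₁ * p₂)}
  {πc : ((Fin n₁ → ℕ) × (Fin n₂ → ℕ)) → Fin (m₁ - n₁) → Fin m₁}
  {π'c : ((Fin n₁ → ℕ) × (Fin n₂ → ℕ)) → Fin (m₂ - n₂) → Fin m₂}
  {gc : ((Fin n₁ → ℕ) × (Fin n₂ → ℕ)) → Fin (m₁ - n₁) → ZMod (p₁ * p₂) → ZMod (p₁ * p₂)}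
  {g'c : ((Fin n₁ → ℕ) × (Fin n₂ → ℕ)) → Fin (m₂ - n₂) → ZMod (p₁ * p₂) → ZMod (p₁ * p₂)}
  {fc hc : ((Fin n₁ → ℕ) × (Fin n₂ → ℕ)) → ZMod (p₁ * p₂) → ZMod (p₁ * p₂)}
  {γc : ((Fin n₁ → ℕ) × (Fin n₂ → ℕ)) → ZMod (p₁ * p₂)}

theorem sum_survivingPairs_eq_zero_of_shift_ne_zero [NeZero p₁] [NeZero p₂]
    (hn₁ : n₁ ≤ m₁) (hn₂ : n₂ ≤ m₂)
    (hJ₁ : Function.Injective J₁) (hJ₂ : Function.Injective J₂)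
    (hfi : ∀ i, PermutesMod (p₁ * p₂) p₁ (fi i) ∧ PermutesMod (p₁ * p₂) p₁ (f'i i))
    (hhj : ∀ j, PermutesMod (p₁ * p₂) p₂ (hj j) ∧ PermutesMod (p₁ * p₂) p₂ (h'j j))
    (hπ : ∀ c, Function.Injective (πc c) ∧ ∀ i j, πc c i ≠ J₁ j)
    (hπ' : ∀ c, Function.Injective (π'c c) ∧ ∀ i j, π'c c i ≠ J₂ j)
    {τ : ℤ} (hτ : τ ≠ 0) (t t' : ℕ) :
    ∑ z ∈ survivingPairs p₁ p₂ hr hr' J₁ J₂ πc π'c τ, ZMod.stdAddChar (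
      codeExponent p₁ p₂ m₁ m₂ n₁ n₂ hr hr' J₁ J₂ fi f'i hj h'j πc π'c gc g'c fc hc γc t z.1 -
      codeExponent p₁ p₂ m₁ m₂ n₁ n₂ hr hr' J₁ J₂ fi f'i hj h'j πc π'c gc g'c fc hc γc t' z.2) =
      0 := by
  refine sum_survivingPairs_eq_zero fun w hw => ?_
  obtain ⟨hw0, hw1, hw2, hw3⟩ := Finset.mem_filter.1 hw
  rw [← hw1] at hw2 hw3
  by_cases hl : ∃ i, mdig p₁ p₂ m₁ w.1 (πc (restr p₁ p₂ J₁ J₂ w.1) i) ≠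
      mdig p₁ p₂ m₁ w.2 (πc (restr p₁ p₂ J₁ J₂ w.1) i)
  · obtain ⟨k, hk, hne⟩ := exists_first_of_not_zero hr (not_not.2 hw2) hl
    exact sum_patternPairs_eq_zero_of_left hfi hπ k (fun i hi => not_not.1 (hk i hi)) hne t t'
  by_cases hl' : ∃ i, mdig p₁ p₂ m₁ w.1 (m₁ + π'c (restr p₁ p₂ J₁ J₂ w.1) i) ≠
      mdig p₁ p₂ m₁ w.2 (m₁ + π'c (restr p₁ p₂ J₁ J₂ w.1) i)
  · obtain ⟨k, hk, hne⟩ := exists_first_of_not_zero hr' (not_not.2 hw3) hl'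
    exact sum_patternPairs_eq_zero_of_right hhj hπ' (fun i => not_not.1 (not_exists.1 hl i)) k
      (fun i hi => not_not.1 (hk i hi)) hne t t'
  push Not at hl hl'
  have hwL := mem_shiftPairs.1 hw0
  have hxy : w.1 = w.2 := by
    refine eq_of_mdig_eq hwL.1.1 hwL.1.2 fun j hj => ?_
    by_cases hjm : j < m₁
    · rcases exists_eq_or_exists_eq hn₁ (hπ (restr p₁ p₂ J₁ J₂ w.1)).1 hJ₁
        (hπ (restr p₁ p₂ J₁ J₂ w.1)).2 ⟨j, hjm⟩ with ⟨i, hi⟩ | ⟨v, hv⟩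
      · simpa only [hi] using hl i
      · have := congrFun (congrArg Prod.fst hw1) v
        simpa only [restr, hv] using this
    · have hjm' : m₁ + (j - m₁) = j := by omega
      rcases exists_eq_or_exists_eq hn₂ (hπ' (restr p₁ p₂ J₁ J₂ w.1)).1 hJ₂
        (hπ' (restr p₁ p₂ J₁ J₂ w.1)).2 ⟨j - m₁, by omega⟩ with ⟨i, hi⟩ | ⟨v, hv⟩
      · simpa only [hi, hjm'] using hl' i
      · have := congrFun (congrArg Prod.snd hw1) v
        simpa only [restr, hv, hjm'] using this
  refine absurd hwL.2 ?_
  rw [hxy, sub_self]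
  exact hτ.symm

theorem codeExponent_sub_codeExponent (t t' x : ℕ) :
    codeExponent p₁ p₂ m₁ m₂ n₁ n₂ hr hr' J₁ J₂ fi f'i hj h'j πc π'c gc g'c fc hc γc t x -
      codeExponent p₁ p₂ m₁ m₂ n₁ n₂ hr hr' J₁ J₂ fi f'i hj h'j πc π'c gc g'c fc hc γc t' x =
    ((p₁ * p₂ / p₁ : ℕ) : ZMod (p₁ * p₂)) *
      (((mdig p₁ p₂ (n₁ + 1) t n₁ : ZMod (p₁ * p₂)) - mdig p₁ p₂ (n₁ + 1) t' n₁) *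
        digitVec p₁ p₂ m₁ (fun i => (πc (restr p₁ p₂ J₁ J₂ x) i : ℕ)) x
          ⟨m₁ - n₁ - 1, by omega⟩) +
    ((p₁ * p₂ / p₂ : ℕ) : ZMod (p₁ * p₂)) *
      (((mdig p₁ p₂ (n₁ + 1) t (n₁ + 1 + n₂) : ZMod (p₁ * p₂)) -
          mdig p₁ p₂ (n₁ + 1) t' (n₁ + 1 + n₂)) *
        digitVec p₁ p₂ m₁ (fun i => m₁ + (π'c (restr p₁ p₂ J₁ J₂ x) i : ℕ)) x
          ⟨m₂ - n₂ - 1, by omega⟩) +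
    ((p₁ * p₂ / p₁ : ℕ) : ZMod (p₁ * p₂)) *
      (∑ v : Fin n₁, ((mdig p₁ p₂ (n₁ + 1) t v : ZMod (p₁ * p₂)) - mdig p₁ p₂ (n₁ + 1) t' v) *
        ((restr p₁ p₂ J₁ J₂ x).1 v : ZMod (p₁ * p₂))) +
    ((p₁ * p₂ / p₂ : ℕ) : ZMod (p₁ * p₂)) *
      (∑ v : Fin n₂, ((mdig p₁ p₂ (n₁ + 1) t (n₁ + 1 + v) : ZMod (p₁ * p₂)) -
        mdig p₁ p₂ (n₁ + 1) t' (n₁ + 1 + v)) * ((restr p₁ p₂ J₁ J₂ x).2 v : ZMod (p₁ * p₂))) := by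
  simp only [codeExponent, phase, sub_mul, Finset.sum_sub_distrib]
  ring

theorem survivingPairs_zero :
    survivingPairs p₁ p₂ hr hr' J₁ J₂ πc π'c 0 = shiftPairs (p₁ ^ m₁ * p₂ ^ m₂) 0 := by
  refine Finset.filter_true_of_mem fun z hz => ?_
  rw [fst_eq_snd_of_mem_shiftPairs_zero hz]
  exact ⟨rfl, rfl, rfl⟩

theorem sum_survivingPairs_zero_of_ne [NeZero p₁] [NeZero p₂]
    (hJ₁ : Function.Injective J₁) (hJ₂ : Function.Injective J₂)
    (hπ : ∀ c, Function.Injective (πc c) ∧ ∀ i j, πc c i ≠ J₁ j)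
    (hπ' : ∀ c, Function.Injective (π'c c) ∧ ∀ i j, π'c c i ≠ J₂ j)
    {t t' : ℕ} (ht : t < p₁ ^ (n₁ + 1) * p₂ ^ (n₂ + 1))
    (ht' : t' < p₁ ^ (n₁ + 1) * p₂ ^ (n₂ + 1)) (hne : t ≠ t') :
    ∑ z ∈ survivingPairs p₁ p₂ hr hr' J₁ J₂ πc π'c 0, ZMod.stdAddChar (
      codeExponent p₁ p₂ m₁ m₂ n₁ n₂ hr hr' J₁ J₂ fi f'i hj h'j πc π'c gc g'c fc hc γc t z.1 -
      codeExponent p₁ p₂ m₁ m₂ n₁ n₂ hr hr' J₁ J₂ fi f'i hj h'j πc π'c gc g'c fc hc γc t' z.2) =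
      0 := by
  have hp₁ : 0 < p₁ := Nat.pos_of_neZero p₁
  have hp₂ : 0 < p₂ := Nat.pos_of_neZero p₂
  have hd₁ : ∀ t v, v < n₁ + 1 → mdig p₁ p₂ (n₁ + 1) t v < p₁ := fun t v hv => by
    simpa [radix, hv] using mdig_lt hp₁ hp₂ (n₁ + 1) t v
  have hd₂ : ∀ t v, mdig p₁ p₂ (n₁ + 1) t (n₁ + 1 + v) < p₂ := fun t v => by
    have h := mdig_lt hp₁ hp₂ (n₁ + 1) t (n₁ + 1 + v)
    rwa [radix, if_neg (by omega)] at h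
  have hrad₁ : ∀ j : Fin m₁, radix p₁ p₂ m₁ j = p₁ := fun j => if_pos j.isLt
  have hrad₂ : ∀ j : ℕ, radix p₁ p₂ m₁ (m₁ + j) = p₂ := fun j => if_neg (by omega)
  have h₁ := dvd_mul_right p₁ p₂
  have h₂ := dvd_mul_left p₂ p₁
  let F : ℕ → ℕ → ℂ := fun x y => ZMod.stdAddChar (
      codeExponent p₁ p₂ m₁ m₂ n₁ n₂ hr hr' J₁ J₂ fi f'i hj h'j πc π'c gc g'c fc hc γc t x -
      codeExponent p₁ p₂ m₁ m₂ n₁ n₂ hr hr' J₁ J₂ fi f'i hj h'j πc π'c gc g'c fc hc γc t' y)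
  by_cases hl₁ : mdig p₁ p₂ (n₁ + 1) t n₁ = mdig p₁ p₂ (n₁ + 1) t' n₁
  swap
  · refine sum_survivingPairs_eq_zero fun w hw => ?_
    have hw0 := fst_eq_snd_of_mem_shiftPairs_zero (Finset.mem_filter.1 hw).1
    set c := restr p₁ p₂ J₁ J₂ w.1
    have hv₁ : ∀ i v, (J₁ v : ℕ) ≠ πc c i := fun i v h => (hπ c).2 i v (Fin.ext h.symm)
    have hv₂ : ∀ i v, m₁ + (J₂ v : ℕ) ≠ πc c i := fun i v => by omega
    refine sum_patternPairs_eq_zero hp₁ hp₂ (j := πc c ⟨m₁ - n₁ - 1, by omega⟩) (by omega)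
      (hv₁ _) (hv₂ _) (by rw [hw0]) F ?_
    intro z hz
    obtain ⟨hz0, hz1, -⟩ := Finset.mem_filter.1 hz
    rw [hrad₁, ← fst_eq_snd_of_mem_shiftPairs_zero hz0]
    simp only [F, codeExponent_sub_codeExponent]
    refine sum_stdAddChar_eq_zero_of_permutesMod h₁ (permutesMod_id h₁)
      (c := (mdig p₁ p₂ (n₁ + 1) t n₁ : ZMod (p₁ * p₂)) - mdig p₁ p₂ (n₁ + 1) t' n₁)
      ((castHom_natCast_sub_eq_zero h₁ (hd₁ _ _ (by omega)) (hd₁ _ _ (by omega))).not.2 hl₁)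
      (C := ?_) ?_
    swap
    · intro u hu
      have hu' : u < radix p₁ p₂ m₁ (πc c ⟨m₁ - n₁ - 1, by omega⟩) := by rwa [hrad₁]
      rw [restr_setDigit hp₁ hp₂ hu' (hv₁ _) (hv₂ _), hz1,
        digitVec_setDigit hp₁ hp₂ (e := fun i => (πc c i : ℕ))
          (Fin.val_injective.comp (hπ c).1) (fun i => by omega) hu',
        digitVec_setDigit_of_ne hp₁ hp₂ (e := fun i => m₁ + (π'c c i : ℕ)) (fun i => by omega)
          (fun i => by omega) hu', Function.update_self, mul_comm (u : ZMod (p₁ * p₂)),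
        add_assoc, add_assoc]
  by_cases hl₂ : mdig p₁ p₂ (n₁ + 1) t (n₁ + 1 + n₂) = mdig p₁ p₂ (n₁ + 1) t' (n₁ + 1 + n₂)
  swap
  · refine sum_survivingPairs_eq_zero fun w hw => ?_
    have hw0 := fst_eq_snd_of_mem_shiftPairs_zero (Finset.mem_filter.1 hw).1
    set c := restr p₁ p₂ J₁ J₂ w.1
    have hv₁ : ∀ i v, (J₁ v : ℕ) ≠ m₁ + π'c c i := fun i v => by omega
    have hv₂ : ∀ i v, m₁ + (J₂ v : ℕ) ≠ m₁ + π'c c i :=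
      fun i v h => (hπ' c).2 i v (Fin.ext (Nat.add_left_cancel h).symm)
    refine sum_patternPairs_eq_zero hp₁ hp₂ (j := m₁ + π'c c ⟨m₂ - n₂ - 1, by omega⟩) (by omega)
      (hv₁ _) (hv₂ _) (by rw [hw0]) F ?_
    intro z hz
    obtain ⟨hz0, hz1, -⟩ := Finset.mem_filter.1 hz
    rw [hrad₂, ← fst_eq_snd_of_mem_shiftPairs_zero hz0]
    simp only [F, codeExponent_sub_codeExponent, hl₁, sub_self, zero_mul, mul_zero, zero_add]
    refine sum_stdAddChar_eq_zero_of_permutesMod h₂ (permutesMod_id h₂)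
      (c := (mdig p₁ p₂ (n₁ + 1) t (n₁ + 1 + n₂) : ZMod (p₁ * p₂)) -
        mdig p₁ p₂ (n₁ + 1) t' (n₁ + 1 + n₂))
      ((castHom_natCast_sub_eq_zero h₂ (hd₂ _ _) (hd₂ _ _)).not.2 hl₂) (C := ?_) ?_
    swap
    · intro u hu
      have hu' : u < radix p₁ p₂ m₁ (m₁ + π'c c ⟨m₂ - n₂ - 1, by omega⟩) := by rwa [hrad₂]
      rw [restr_setDigit hp₁ hp₂ hu' (hv₁ _) (hv₂ _), hz1,
        digitVec_setDigit hp₁ hp₂ (e := fun i => m₁ + (π'c c i : ℕ))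
          ((add_right_injective m₁).comp (Fin.val_injective.comp (hπ' c).1))
          (fun i => by omega) hu', Function.update_self, mul_comm (u : ZMod (p₁ * p₂)),
        add_assoc]
  have hclosed : ∀ j, ∀ z ∈ shiftPairs (p₁ ^ m₁ * p₂ ^ m₂) 0, ∀ u < radix p₁ p₂ m₁ j,
      (setDigit p₁ p₂ m₁ m₂ z.1 j u, setDigit p₁ p₂ m₁ m₂ z.2 j u) ∈
        shiftPairs (p₁ ^ m₁ * p₂ ^ m₂) 0 := fun j z hz u hu =>
    setDigit_mem_shiftPairs hp₁ hp₂ hz hu (by rw [fst_eq_snd_of_mem_shiftPairs_zero hz])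
  rw [survivingPairs_zero]
  by_cases hv : ∃ v : Fin n₁, mdig p₁ p₂ (n₁ + 1) t v ≠ mdig p₁ p₂ (n₁ + 1) t' v
  · obtain ⟨v, hv⟩ := hv
    refine sum_eq_zero_of_sum_setDigit hp₁ hp₂ (j := J₁ v) (by omega) (Finset.Subset.refl _) F
      (fun z hz => by rw [fst_eq_snd_of_mem_shiftPairs_zero hz]) (hclosed _) fun z hz => ?_
    rw [hrad₁, ← fst_eq_snd_of_mem_shiftPairs_zero hz]
    simp only [F, codeExponent_sub_codeExponent, hl₁, hl₂, sub_self, zero_mul, mul_zero, zero_add]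
    refine sum_stdAddChar_eq_zero_of_permutesMod h₁ (permutesMod_id h₁)
      (c := (mdig p₁ p₂ (n₁ + 1) t v : ZMod (p₁ * p₂)) - mdig p₁ p₂ (n₁ + 1) t' v)
      ((castHom_natCast_sub_eq_zero h₁ (hd₁ _ _ (by omega)) (hd₁ _ _ (by omega))).not.2 hv)
      (C := ?_) ?_
    swap
    · intro u hu
      have hu' : u < radix p₁ p₂ m₁ (J₁ v) := by rwa [hrad₁]
      have hc₁ := digitVec_setDigit (m₂ := m₂) hp₁ hp₂ (e := fun v => (J₁ v : ℕ))
        (Fin.val_injective.comp hJ₁) (fun i => by omega) hu' z.1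
      have hc₂ := digitVec_setDigit_of_ne (m₂ := m₂) hp₁ hp₂ (e := fun v => m₁ + (J₂ v : ℕ))
        (fun i => by omega) (fun i => by omega) hu' z.1
      simp only [restr]
      change _ * (∑ w, _ * digitVec p₁ p₂ m₁ (fun v => (J₁ v : ℕ)) _ w) +
        _ * (∑ w, _ * digitVec p₁ p₂ m₁ (fun v => m₁ + (J₂ v : ℕ)) _ w) = _
      rw [hc₁, hc₂, sum_mul_update, mul_add, add_assoc, mul_comm (u : ZMod (p₁ * p₂))]
  · push Not at hv
    obtain ⟨v, hv'⟩ : ∃ v : Fin n₂,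
        mdig p₁ p₂ (n₁ + 1) t (n₁ + 1 + v) ≠ mdig p₁ p₂ (n₁ + 1) t' (n₁ + 1 + v) := by
      by_contra! hcon
      refine hne (eq_of_mdig_eq ht ht' fun j hj => ?_)
      rcases lt_trichotomy j n₁ with hj1 | rfl | hj1
      · exact hv ⟨j, hj1⟩
      · exact hl₁
      · obtain ⟨i, rfl⟩ : ∃ i, j = n₁ + 1 + i := ⟨j - (n₁ + 1), by omega⟩
        by_cases hi : i < n₂
        · exact hcon ⟨i, hi⟩
        · obtain rfl : i = n₂ := by omega
          exact hl₂
    refine sum_eq_zero_of_sum_setDigit hp₁ hp₂ (j := m₁ + J₂ v) (by omega)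
      (Finset.Subset.refl _) F
      (fun z hz => by rw [fst_eq_snd_of_mem_shiftPairs_zero hz]) (hclosed _) fun z hz => ?_
    rw [hrad₂, ← fst_eq_snd_of_mem_shiftPairs_zero hz]
    simp only [F, codeExponent_sub_codeExponent, hl₁, hl₂, hv, sub_self, zero_mul, mul_zero,
      zero_add, Finset.sum_const_zero]
    refine sum_stdAddChar_eq_zero_of_permutesMod h₂ (permutesMod_id h₂)
      (c := (mdig p₁ p₂ (n₁ + 1) t (n₁ + 1 + v) : ZMod (p₁ * p₂)) -
        mdig p₁ p₂ (n₁ + 1) t' (n₁ + 1 + v))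
      ((castHom_natCast_sub_eq_zero h₂ (hd₂ _ _) (hd₂ _ _)).not.2 hv') (C := ?_) ?_
    swap
    · intro u hu
      have hu' : u < radix p₁ p₂ m₁ (m₁ + J₂ v) := by rwa [hrad₂]
      have hc₂ := digitVec_setDigit (m₂ := m₂) hp₁ hp₂ (e := fun v => m₁ + (J₂ v : ℕ))
        ((add_right_injective m₁).comp (Fin.val_injective.comp hJ₂)) (fun i => by omega) hu' z.1
      simp only [restr]
      change _ * (∑ w, _ * digitVec p₁ p₂ m₁ (fun v => m₁ + (J₂ v : ℕ)) _ w) = _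
      rw [hc₂, sum_mul_update, mul_add, mul_comm (u : ZMod (p₁ * p₂))]

/-- If all the functions along the paths are permutations, the codes are complementary. -/
theorem isCCC_psi2r [NeZero p₁] [NeZero p₂] (hm₁ : 2 ≤ m₁) (hm₂ : 2 ≤ m₂)
    (hn₁ : n₁ ≤ m₁ - 1) (hn₂ : n₂ ≤ m₂ - 1)
    (hJ₁ : Function.Injective J₁) (hJ₂ : Function.Injective J₂)
    (hfi : ∀ i, PermutesMod (p₁ * p₂) p₁ (fi i) ∧ PermutesMod (p₁ * p₂) p₁ (f'i i))
    (hhj : ∀ j, PermutesMod (p₁ * p₂) p₂ (hj j) ∧ PermutesMod (p₁ * p₂) p₂ (h'j j))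
    (hπ : ∀ c, Function.Injective (πc c) ∧ ∀ i j, πc c i ≠ J₁ j)
    (hπ' : ∀ c, Function.Injective (π'c c) ∧ ∀ i j, π'c c i ≠ J₂ j) :
    IsCCC (p₁ ^ m₁ * p₂ ^ m₂) (fun t : Fin (p₁ ^ (n₁ + 1) * p₂ ^ (n₂ + 1)) =>
      psi2r p₁ p₂ m₁ m₂ n₁ n₂ hm₁ hm₂ hn₁ hn₂ J₁ J₂ fi f'i hj h'j πc π'c
        gc g'c fc hc γc t.val) := by
  refine ⟨by simp [pow_succ]; ring, fun t t' τ _ => ?_⟩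
  rw [codeACCF_psi2r hm₁ hm₂ hn₁ hn₂ (by omega) (by omega)]
  split_ifs with h
  · obtain ⟨rfl, rfl⟩ := h
    rw [survivingPairs_zero, Finset.sum_congr rfl (g := fun _ => (1 : ℂ)) fun z hz => by
      rw [fst_eq_snd_of_mem_shiftPairs_zero hz, sub_self, AddChar.map_zero_eq_one]]
    simp [card_shiftPairs_zero]
  · rcases eq_or_ne τ 0 with rfl | hτ
    · rw [sum_survivingPairs_zero_of_ne hJ₁ hJ₂ hπ hπ' t.isLt t'.isLt
        fun htt => h ⟨rfl, Fin.ext htt⟩, mul_zero]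
    · rw [sum_survivingPairs_eq_zero_of_shift_ne_zero (by omega) (by omega) hJ₁ hJ₂ hfi hhj hπ hπ'
        hτ, mul_zero]

end

section

variable {p₁ p₂ m₁ m₂ n₁ n₂ : ℕ}

/-- Positions of the digits that are not restricted, listed along the two paths. -/
def freePos {r r' : ℕ} (π : Fin r → Fin m₁) (π' : Fin r' → Fin m₂) : Fin r ⊕ Fin r' → ℕ :=
  Sum.elim (fun i => (π i : ℕ)) (fun i => m₁ + (π' i : ℕ))

/-- The digits that are not restricted, listed along the two paths. -/
def freeDigits (p₁ p₂ : ℕ) {r r' : ℕ} (π : Fin r → Fin m₁) (π' : Fin r' → Fin m₂) (x : ℕ) :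
    Fin r ⊕ Fin r' → ZMod (p₁ * p₂) :=
  Sum.elim (digitVec p₁ p₂ m₁ (fun i => (π i : ℕ)) x)
    (digitVec p₁ p₂ m₁ (fun i => m₁ + (π' i : ℕ)) x)

theorem freePos_lt {r r' : ℕ} (π : Fin r → Fin m₁) (π' : Fin r' → Fin m₂) (i : Fin r ⊕ Fin r') :
    freePos π π' i < m₁ + m₂ := by
  rcases i with i | i <;> simp only [freePos, Sum.elim_inl, Sum.elim_inr] <;> omega

theorem freePos_injective {r r' : ℕ} {π : Fin r → Fin m₁} {π' : Fin r' → Fin m₂}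
    (hπ : Function.Injective π) (hπ' : Function.Injective π') :
    Function.Injective (freePos π π') :=
  (Fin.val_injective.comp hπ).sumElim
    ((add_right_injective m₁).comp (Fin.val_injective.comp hπ')) fun i j => by
      simp only [Function.comp_apply]
      omega

theorem freeDigits_apply_eq_iff (hp₁ : 0 < p₁) (hp₂ : 0 < p₂) {r r' : ℕ} (π : Fin r → Fin m₁)
    (π' : Fin r' → Fin m₂) (x y : ℕ) (i : Fin r ⊕ Fin r') :
    freeDigits p₁ p₂ π π' x i = freeDigits p₁ p₂ π π' y i ↔
      mdig p₁ p₂ m₁ x (freePos π π' i) = mdig p₁ p₂ m₁ y (freePos π π' i) := by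
  rcases i with i | i
  · exact digitVec_apply_eq_iff hp₁ hp₂ (fun i => (π i : ℕ)) x y i
  · exact digitVec_apply_eq_iff hp₁ hp₂ (fun i => m₁ + (π' i : ℕ)) x y i

theorem freeDigits_eq {r r' : ℕ} (π : Fin r → Fin m₁) (π' : Fin r' → Fin m₂) (x : ℕ)
    (i : Fin r ⊕ Fin r') : freeDigits p₁ p₂ π π' x i = (mdig p₁ p₂ m₁ x (freePos π π' i) : ℕ) := by
  rcases i with i | i <;> rfl

/-- The part of the exponent difference at the pair `z` that comes from the two paths. -/
def pathDiff (p₁ p₂ : ℕ) {m₁ m₂ r r' : ℕ} (f f' : Fin (r - 1) → ZMod (p₁ * p₂) → ZMod (p₁ * p₂))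
    (h h' : Fin (r' - 1) → ZMod (p₁ * p₂) → ZMod (p₁ * p₂)) (π : Fin r → Fin m₁)
    (π' : Fin r' → Fin m₂) (x y : ℕ) : ZMod (p₁ * p₂) :=
  ((p₁ * p₂ / p₁ : ℕ) : ZMod (p₁ * p₂)) *
      (pathSum f f' (digitVec p₁ p₂ m₁ (fun i => (π i : ℕ)) x) -
        pathSum f f' (digitVec p₁ p₂ m₁ (fun i => (π i : ℕ)) y)) +
    ((p₁ * p₂ / p₂ : ℕ) : ZMod (p₁ * p₂)) *
      (pathSum h h' (digitVec p₁ p₂ m₁ (fun i => m₁ + (π' i : ℕ)) x) -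
        pathSum h h' (digitVec p₁ p₂ m₁ (fun i => m₁ + (π' i : ℕ)) y))

/-- The surviving pairs whose free digits are similar to those of `w`. -/
noncomputable def similarPairs (p₁ p₂ : ℕ) {m₁ m₂ n₁ n₂ : ℕ} (hr : 0 < m₁ - n₁)
    (hr' : 0 < m₂ - n₂) (J₁ : Fin n₁ → Fin m₁) (J₂ : Fin n₂ → Fin m₂)
    (π : Fin (m₁ - n₁) → Fin m₁) (π' : Fin (m₂ - n₂) → Fin m₂) (w : ℕ × ℕ) : Finset (ℕ × ℕ) :=
  (survivingPairs p₁ p₂ hr hr' J₁ J₂ (fun _ => π) (fun _ => π') ((w.2 : ℤ) - w.1)).filter fun z =>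
    SimilarPair (freeDigits p₁ p₂ π π' w.1) (freeDigits p₁ p₂ π π' w.2)
      (freeDigits p₁ p₂ π π' z.1) (freeDigits p₁ p₂ π π' z.2)

/-- If the digits of `w.1` and `w.2` along a path agree up to `k` and `z` is similar to `w`, then
replacing the digit number `k` of `z` affects the path sums only through one edge. -/
theorem pathSum_setDigit_sub (hp₁ : 0 < p₁) (hp₂ : 0 < p₂) {r : ℕ} {e : Fin r → ℕ}
    (he : Function.Injective e) (hlt : ∀ i, e i < m₁ + m₂)
    (f f' : Fin (r - 1) → ZMod (p₁ * p₂) → ZMod (p₁ * p₂)) (k : Fin (r - 1)) {w z : ℕ × ℕ}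
    (hw : ∀ i : Fin r, digitVec p₁ p₂ m₁ e w.1 i = digitVec p₁ p₂ m₁ e w.2 i ↔ (i : ℕ) ≤ k)
    (hz : SimilarPair (digitVec p₁ p₂ m₁ e w.1) (digitVec p₁ p₂ m₁ e w.2)
      (digitVec p₁ p₂ m₁ e z.1) (digitVec p₁ p₂ m₁ e z.2)) {u : ℕ}
    (hu : u < radix p₁ p₂ m₁ (e ⟨k, by omega⟩)) :
    pathSum f f' (digitVec p₁ p₂ m₁ e (setDigit p₁ p₂ m₁ m₂ z.1 (e ⟨k, by omega⟩) u)) -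
        pathSum f f' (digitVec p₁ p₂ m₁ e (setDigit p₁ p₂ m₁ m₂ z.2 (e ⟨k, by omega⟩) u)) =
      f k (u : ZMod (p₁ * p₂)) * (f' k (digitVec p₁ p₂ m₁ e w.1 ⟨k + 1, by omega⟩) -
        f' k (digitVec p₁ p₂ m₁ e w.2 ⟨k + 1, by omega⟩)) +
        (pathTail f f' k (digitVec p₁ p₂ m₁ e w.1) -
          pathTail f f' k (digitVec p₁ p₂ m₁ e w.2)) := by
  have hgt : ∀ i : Fin r, (k : ℕ) < i → digitVec p₁ p₂ m₁ e z.1 i = digitVec p₁ p₂ m₁ e w.1 i ∧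
      digitVec p₁ p₂ m₁ e z.2 i = digitVec p₁ p₂ m₁ e w.2 i := fun i hi =>
    (hz i).2 fun h => absurd ((hw i).1 h) (by omega)
  rw [digitVec_setDigit hp₁ hp₂ he hlt hu, digitVec_setDigit hp₁ hp₂ he hlt hu,
    pathSum_update_sub f f' k fun i hi => (hz i).1 ((hw i).2 hi),
    (hgt ⟨k + 1, by omega⟩ (Nat.lt_succ_self _)).1, (hgt ⟨k + 1, by omega⟩ (Nat.lt_succ_self _)).2,
    pathTail_congr f f' k fun i hi => (hgt i hi).1, pathTail_congr f f' k fun i hi => (hgt i hi).2]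

/-- A pair of positions whose digits are `a` and `b` on the set `P`, and zero elsewhere. -/
theorem exists_pair_mdig_eq (hp₁ : 0 < p₁) (hp₂ : 0 < p₂) (m₁ m₂ : ℕ) (P : ℕ → Prop) {a b : ℕ}
    (ha : ∀ j, P j → a < radix p₁ p₂ m₁ j) (hb : ∀ j, P j → b < radix p₁ p₂ m₁ j) :
    ∃ w : ℕ × ℕ, w.1 < p₁ ^ m₁ * p₂ ^ m₂ ∧ w.2 < p₁ ^ m₁ * p₂ ^ m₂ ∧
      ∀ j < m₁ + m₂, mdig p₁ p₂ m₁ w.1 j = (if P j then a else 0) ∧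
        mdig p₁ p₂ m₁ w.2 j = if P j then b else 0 := by
  have hpos : ∀ j, 0 < radix p₁ p₂ m₁ j := fun j => by
    unfold radix
    split_ifs <;> assumption
  obtain ⟨x, hx, hx'⟩ := exists_mdig_eq hp₁ hp₂ m₁ m₂ (fun j => if P j then a else 0)
    (fun j _ => by split_ifs with h; exacts [ha j h, hpos j])
  obtain ⟨y, hy, hy'⟩ := exists_mdig_eq hp₁ hp₂ m₁ m₂ (fun j => if P j then b else 0)
    (fun j _ => by split_ifs with h; exacts [hb j h, hpos j])
  exact ⟨(x, y), hx, hy, fun j hj => ⟨hx' j hj, hy' j hj⟩⟩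

variable {hr : 0 < m₁ - n₁} {hr' : 0 < m₂ - n₂} {J₁ : Fin n₁ → Fin m₁} {J₂ : Fin n₂ → Fin m₂}
  {fi f'i : Fin (m₁ - n₁ - 1) → ZMod (p₁ * p₂) → ZMod (p₁ * p₂)}
  {hj h'j : Fin (m₂ - n₂ - 1) → ZMod (p₁ * p₂) → ZMod (p₁ * p₂)}
  {π : Fin (m₁ - n₁) → Fin m₁} {π' : Fin (m₂ - n₂) → Fin m₂}

theorem sum_similarPairs_eq_zero [NeZero p₁] [NeZero p₂] (hq : 2 < p₁ * p₂)
    (hm₁ : 2 ≤ m₁) (hm₂ : 2 ≤ m₂) (hn₁ : n₁ ≤ m₁ - 1) (hn₂ : n₂ ≤ m₂ - 1)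
    (hccc : ∀ (gc : ((Fin n₁ → ℕ) × (Fin n₂ → ℕ)) → Fin (m₁ - n₁) →
        ZMod (p₁ * p₂) → ZMod (p₁ * p₂)) (g'c : ((Fin n₁ → ℕ) × (Fin n₂ → ℕ)) → Fin (m₂ - n₂) →
        ZMod (p₁ * p₂) → ZMod (p₁ * p₂)),
      IsCCC (p₁ ^ m₁ * p₂ ^ m₂) (fun t : Fin (p₁ ^ (n₁ + 1) * p₂ ^ (n₂ + 1)) =>
        psi2r p₁ p₂ m₁ m₂ n₁ n₂ hm₁ hm₂ hn₁ hn₂ J₁ J₂ fi f'i hj h'j (fun _ => π) (fun _ => π')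
          gc g'c 0 0 0 t.val))
    {w : ℕ × ℕ} (hw₁ : w.1 < p₁ ^ m₁ * p₂ ^ m₂) (hw₂ : w.2 < p₁ ^ m₁ * p₂ ^ m₂)
    (hw : w.1 ≠ w.2) :
    ∑ z ∈ similarPairs p₁ p₂ hr hr' J₁ J₂ π π' w,
      ZMod.stdAddChar (pathDiff p₁ p₂ fi f'i hj h'j π π' z.1 z.2) = 0 := by
  have hK : p₁ ^ (n₁ + 1) * p₂ ^ (n₂ + 1) ≠ 0 :=
    mul_ne_zero (pow_ne_zero _ (NeZero.ne p₁)) (pow_ne_zero _ (NeZero.ne p₂))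
  have hd : ∀ j, mdig p₁ p₂ (n₁ + 1) 0 j = 0 := fun j => by simp [mdig]
  have hsum := sum_similarPair_eq_zero hq
    (survivingPairs p₁ p₂ hr hr' J₁ J₂ (fun _ => π) (fun _ => π') ((w.2 : ℤ) - w.1))
    (fun z => pathDiff p₁ p₂ fi f'i hj h'j π π' z.1 z.2) (fun z => freeDigits p₁ p₂ π π' z.1)
    (fun z => freeDigits p₁ p₂ π π' z.2) (fun g => ?_)
    (freeDigits p₁ p₂ π π' w.1) (freeDigits p₁ p₂ π π' w.2)
  · exact hsum
  have h := (hccc (fun _ i => g (Sum.inl i)) (fun _ i => g (Sum.inr i))).2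
    ⟨0, Nat.pos_of_ne_zero hK⟩ ⟨0, Nat.pos_of_ne_zero hK⟩ ((w.2 : ℤ) - w.1)
    (abs_lt.2 ⟨by omega, by omega⟩)
  rw [codeACCF_psi2r hm₁ hm₂ hn₁ hn₂ hr hr', if_neg (by omega)] at h
  rw [← (mul_eq_zero.1 h).resolve_left (by exact_mod_cast hK)]
  refine Finset.sum_congr rfl fun z _ => ?_
  congr 1
  simp only [codeExponent, phase, hd, pathDiff, freeDigits, Fintype.sum_sum_type, Sum.elim_inl,
    Sum.elim_inr, Finset.sum_sub_distrib, Nat.cast_zero, zero_mul, mul_zero, Pi.zero_apply,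
    Finset.sum_const_zero]
  ring

theorem sum_range_radix_eq_zero (hp₁ : 0 < p₁) (hp₂ : 0 < p₂)
    (hπ : Function.Injective π ∧ ∀ i j, π i ≠ J₁ j)
    (hπ' : Function.Injective π' ∧ ∀ i j, π' i ≠ J₂ j) {w : ℕ × ℕ}
    (hw : w ∈ similarPairs p₁ p₂ hr hr' J₁ J₂ π π' w) {k : Fin (m₁ - n₁) ⊕ Fin (m₂ - n₂)}
    (hk : mdig p₁ p₂ m₁ w.1 (freePos π π' k) = mdig p₁ p₂ m₁ w.2 (freePos π π' k))
    {Q : ℕ → ℕ → ZMod (p₁ * p₂)} [NeZero (p₁ * p₂)] {G : ℕ → ZMod (p₁ * p₂)}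
    {C : ZMod (p₁ * p₂)}
    (hQ : ∀ z ∈ similarPairs p₁ p₂ hr hr' J₁ J₂ π π' w,
      ∀ u < radix p₁ p₂ m₁ (freePos π π' k),
      Q (setDigit p₁ p₂ m₁ m₂ z.1 (freePos π π' k) u)
        (setDigit p₁ p₂ m₁ m₂ z.2 (freePos π π' k) u) = G u + C)
    (hs : ∑ z ∈ similarPairs p₁ p₂ hr hr' J₁ J₂ π π' w, ZMod.stdAddChar (Q z.1 z.2) = 0) :
    ∑ u ∈ Finset.range (radix p₁ p₂ m₁ (freePos π π' k)), ZMod.stdAddChar (G u) = 0 := by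
  set j := freePos π π' k with hjk
  have hjlt : j < m₁ + m₂ := freePos_lt π π' k
  have hJ : (∀ v, (J₁ v : ℕ) ≠ j) ∧ ∀ v, m₁ + (J₂ v : ℕ) ≠ j := by
    rcases k with k | k
    · exact ⟨fun v h => hπ.2 k v (Fin.ext h.symm), fun v h => by
        simp only [hjk, freePos, Sum.elim_inl] at h; omega⟩
    · refine ⟨fun v h => by simp only [hjk, freePos, Sum.elim_inr] at h; omega, fun v h => ?_⟩
      exact hπ'.2 k v (Fin.ext (Nat.add_left_cancel h).symm)
  have heq : ∀ z ∈ similarPairs p₁ p₂ hr hr' J₁ J₂ π π' w,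
      mdig p₁ p₂ m₁ z.1 j = mdig p₁ p₂ m₁ z.2 j := fun z hz =>
    (freeDigits_apply_eq_iff hp₁ hp₂ π π' z.1 z.2 k).1 (((Finset.mem_filter.1 hz).2 k).1
      ((freeDigits_apply_eq_iff hp₁ hp₂ π π' w.1 w.2 k).2 hk))
  have hlt : ∀ z ∈ similarPairs p₁ p₂ hr hr' J₁ J₂ π π' w,
      z.1 < p₁ ^ m₁ * p₂ ^ m₂ ∧ z.2 < p₁ ^ m₁ * p₂ ^ m₂ := fun z hz =>
    (mem_shiftPairs.1 (Finset.mem_filter.1 (Finset.mem_filter.1 hz).1).1).1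
  have hclosed : ∀ z ∈ similarPairs p₁ p₂ hr hr' J₁ J₂ π π' w, ∀ u < radix p₁ p₂ m₁ j,
      (setDigit p₁ p₂ m₁ m₂ z.1 j u, setDigit p₁ p₂ m₁ m₂ z.2 j u) ∈
        similarPairs p₁ p₂ hr hr' J₁ J₂ π π' w := by
    intro z hz u hu
    have hzj := heq z hz
    obtain ⟨hz', hzs⟩ := Finset.mem_filter.1 hz
    obtain ⟨hz0, hz1, hz2, hz3⟩ := Finset.mem_filter.1 hz'
    have hdig : ∀ i < m₁ + m₂, mdig p₁ p₂ m₁ z.1 i = mdig p₁ p₂ m₁ z.2 i →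
        mdig p₁ p₂ m₁ (setDigit p₁ p₂ m₁ m₂ z.1 j u) i =
          mdig p₁ p₂ m₁ (setDigit p₁ p₂ m₁ m₂ z.2 j u) i := by
      intro i hi h
      rw [(setDigit_spec hp₁ hp₂ z.1 hu).2 i hi, (setDigit_spec hp₁ hp₂ z.2 hu).2 i hi]
      rcases eq_or_ne i j with rfl | hij
      · simp
      · simp [hij, h]
    refine Finset.mem_filter.2 ⟨Finset.mem_filter.2 ⟨setDigit_mem_shiftPairs hp₁ hp₂ hz0 hu hzj,
      ?_, hdig _ (by omega) hz2, hdig _ (by omega) hz3⟩, fun i => ⟨fun h0 => ?_, fun h0 => ?_⟩⟩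
    · rw [restr_setDigit hp₁ hp₂ hu hJ.1 hJ.2, restr_setDigit hp₁ hp₂ hu hJ.1 hJ.2, hz1]
    · rw [freeDigits_apply_eq_iff hp₁ hp₂]
      exact hdig _ (freePos_lt π π' i)
        ((freeDigits_apply_eq_iff hp₁ hp₂ π π' _ _ i).1 ((hzs i).1 h0))
    · have hik : freePos π π' i ≠ j := by
        rw [hjk, (freePos_injective hπ.1 hπ'.1).ne_iff]
        rintro rfl
        exact h0 ((freeDigits_apply_eq_iff hp₁ hp₂ π π' w.1 w.2 i).2 hk)
      obtain ⟨h1, h2⟩ := (hzs i).2 h0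
      simp only [freeDigits_eq] at h1 h2 ⊢
      rw [(setDigit_spec hp₁ hp₂ z.1 hu).2 _ (freePos_lt π π' i),
        (setDigit_spec hp₁ hp₂ z.2 hu).2 _ (freePos_lt π π' i), Function.update_of_ne hik,
        Function.update_of_ne hik]
      exact ⟨h1, h2⟩
  have h := sum_sum_setDigit hp₁ hp₂ hjlt _ (fun x y => ZMod.stdAddChar (Q x y)) hlt heq hclosed
  rw [hs, mul_zero, Finset.sum_congr rfl (g := fun _ => ZMod.stdAddChar C *
    ∑ u ∈ Finset.range (radix p₁ p₂ m₁ j), ZMod.stdAddChar (G u)) fun z hz => by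
      rw [Finset.mul_sum]
      refine Finset.sum_congr rfl fun u hu => ?_
      rw [hQ z hz u (Finset.mem_range.1 hu), AddChar.map_add_eq_mul, mul_comm],
    Finset.sum_const, nsmul_eq_mul] at h
  refine ((mul_eq_zero.1 h).resolve_left ?_ |> mul_eq_zero.1).resolve_left ?_
  · exact_mod_cast (Finset.card_pos.2 ⟨w, hw⟩).ne'
  · exact (AddChar.val_isUnit _ C).ne_zero

theorem mem_similarPairs_self {w : ℕ × ℕ} (hw₁ : w.1 < p₁ ^ m₁ * p₂ ^ m₂)
    (hw₂ : w.2 < p₁ ^ m₁ * p₂ ^ m₂)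
    (hJ₁ : ∀ v, mdig p₁ p₂ m₁ w.1 (J₁ v) = mdig p₁ p₂ m₁ w.2 (J₁ v))
    (hJ₂ : ∀ v, mdig p₁ p₂ m₁ w.1 (m₁ + J₂ v) = mdig p₁ p₂ m₁ w.2 (m₁ + J₂ v))
    (h₁ : mdig p₁ p₂ m₁ w.1 (π ⟨0, hr⟩) = mdig p₁ p₂ m₁ w.2 (π ⟨0, hr⟩))
    (h₂ : mdig p₁ p₂ m₁ w.1 (m₁ + π' ⟨0, hr'⟩) = mdig p₁ p₂ m₁ w.2 (m₁ + π' ⟨0, hr'⟩)) :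
    w ∈ similarPairs p₁ p₂ hr hr' J₁ J₂ π π' w :=
  Finset.mem_filter.2 ⟨Finset.mem_filter.2 ⟨mem_shiftPairs.2 ⟨⟨hw₁, hw₂⟩, rfl⟩,
    Prod.ext (funext hJ₁) (funext hJ₂), h₁, h₂⟩, fun _ => ⟨id, fun _ => ⟨rfl, rfl⟩⟩⟩

theorem permutesMod_left_of_isCCC [NeZero p₁] [NeZero p₂] (hq : 2 < p₁ * p₂)
    (hm₁ : 2 ≤ m₁) (hm₂ : 2 ≤ m₂) (hn₁ : n₁ ≤ m₁ - 1) (hn₂ : n₂ ≤ m₂ - 1)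
    (hccc : ∀ (gc : ((Fin n₁ → ℕ) × (Fin n₂ → ℕ)) → Fin (m₁ - n₁) →
        ZMod (p₁ * p₂) → ZMod (p₁ * p₂)) (g'c : ((Fin n₁ → ℕ) × (Fin n₂ → ℕ)) → Fin (m₂ - n₂) →
        ZMod (p₁ * p₂) → ZMod (p₁ * p₂)),
      IsCCC (p₁ ^ m₁ * p₂ ^ m₂) (fun t : Fin (p₁ ^ (n₁ + 1) * p₂ ^ (n₂ + 1)) =>
        psi2r p₁ p₂ m₁ m₂ n₁ n₂ hm₁ hm₂ hn₁ hn₂ J₁ J₂ fi f'i hj h'j (fun _ => π) (fun _ => π')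
          gc g'c 0 0 0 t.val))
    (hπ : Function.Injective π ∧ ∀ i j, π i ≠ J₁ j)
    (hπ' : Function.Injective π' ∧ ∀ i j, π' i ≠ J₂ j) (k : Fin (m₁ - n₁ - 1)) :
    PermutesMod (p₁ * p₂) p₁ (fi k) ∧ PermutesMod (p₁ * p₂) p₁ (f'i k) := by
  have hp₁ : 0 < p₁ := Nat.pos_of_neZero p₁
  have hp₂ : 0 < p₂ := Nat.pos_of_neZero p₂
  have hr : 0 < m₁ - n₁ := by omega
  have hr' : 0 < m₂ - n₂ := by omega
  refine permutesMod_of_sum_eq_zero (dvd_mul_right p₁ p₂) fun a ha b hb hab => ?_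
  let e : Fin (m₁ - n₁) → ℕ := fun i => π i
  have he : Function.Injective e := Fin.val_injective.comp hπ.1
  have hlt : ∀ i, e i < m₁ + m₂ := fun i => freePos_lt π π' (Sum.inl i)
  have hrad : ∀ i, radix p₁ p₂ m₁ (e i) = p₁ := fun i => if_pos (π i).isLt
  let P : ℕ → Prop := fun j => ∃ i : Fin (m₁ - n₁), (k : ℕ) < i ∧ j = e i
  have hPe : ∀ i, P (e i) ↔ (k : ℕ) < i := fun i =>
    ⟨fun ⟨i', h, h'⟩ => he h' ▸ h, fun h => ⟨i, h, rfl⟩⟩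
  have hPm : ∀ j, ¬P (m₁ + j) := by
    rintro j ⟨i, -, h⟩
    simp only [e] at h
    omega
  obtain ⟨w, hw₁, hw₂, hw⟩ := exists_pair_mdig_eq hp₁ hp₂ m₁ m₂ P (a := a) (b := b)
    (by rintro _ ⟨i, -, rfl⟩; rwa [hrad]) (by rintro _ ⟨i, -, rfl⟩; rwa [hrad])
  have hnP : ∀ j < m₁ + m₂, ¬P j → mdig p₁ p₂ m₁ w.1 j = mdig p₁ p₂ m₁ w.2 j := fun j hj hP => by
    rw [(hw j hj).1, (hw j hj).2, if_neg hP, if_neg hP]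
  have hPeq : ∀ i, digitVec p₁ p₂ m₁ e w.1 i = digitVec p₁ p₂ m₁ e w.2 i ↔ (i : ℕ) ≤ k := by
    intro i
    rw [digitVec_apply_eq_iff hp₁ hp₂, ← not_lt, ← hPe]
    refine ⟨fun h hP => ?_, hnP _ (hlt i)⟩
    rw [(hw _ (hlt i)).1, (hw _ (hlt i)).2, if_pos hP, if_pos hP] at h
    exact hab h
  have hmem : w ∈ similarPairs p₁ p₂ hr hr' J₁ J₂ π π' w := by
    refine mem_similarPairs_self hw₁ hw₂ (fun v => hnP _ (by omega) ?_)
      (fun v => hnP _ (by omega) (hPm _)) (hnP _ (by omega) ?_) (hnP _ (by omega) (hPm _))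
    · rintro ⟨i, -, h⟩
      exact hπ.2 i v (Fin.ext h.symm)
    · exact (hPe ⟨0, hr⟩).not.2 (Nat.not_lt_zero _)
  have hne : w.1 ≠ w.2 := fun h => by
    have := (hPeq ⟨k + 1, by omega⟩).1 (by rw [h])
    simp at this
  have hs := sum_similarPairs_eq_zero (hr := hr) (hr' := hr') hq hm₁ hm₂ hn₁ hn₂ hccc hw₁ hw₂ hne
  have h := sum_range_radix_eq_zero hp₁ hp₂ hπ hπ' hmem (k := Sum.inl ⟨k, by omega⟩)
    (hnP _ (hlt _) ((hPe _).not.2 (lt_irrefl _)))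
    (G := fun u => ((p₁ * p₂ / p₁ : ℕ) : ZMod (p₁ * p₂)) * (fi k u * (f'i k a - f'i k b)))
    (C := ((p₁ * p₂ / p₁ : ℕ) : ZMod (p₁ * p₂)) *
      (pathTail fi f'i k (digitVec p₁ p₂ m₁ e w.1) - pathTail fi f'i k (digitVec p₁ p₂ m₁ e w.2)))
    ?_ hs
  · rwa [show freePos π π' (Sum.inl ⟨k, by omega⟩) = e ⟨k, by omega⟩ from rfl, hrad] at h
  intro z hz u hu
  have hz := (Finset.mem_filter.1 hz).2
  have h1 := pathSum_setDigit_sub hp₁ hp₂ he hlt fi f'i k hPeq (fun i => hz (Sum.inl i)) hu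
  have hk1 : P (e ⟨k + 1, by omega⟩) := (hPe _).2 (Nat.lt_succ_self _)
  have ha' : digitVec p₁ p₂ m₁ e w.1 ⟨k + 1, by omega⟩ = a := by
    simp only [digitVec, mdigZ, (hw _ (hlt ⟨k + 1, by omega⟩)).1, if_pos hk1]
  have hb' : digitVec p₁ p₂ m₁ e w.2 ⟨k + 1, by omega⟩ = b := by
    simp only [digitVec, mdigZ, (hw _ (hlt ⟨k + 1, by omega⟩)).2, if_pos hk1]
  rw [ha', hb'] at h1
  have h2 : digitVec p₁ p₂ m₁ (fun i => m₁ + (π' i : ℕ)) z.1 =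
      digitVec p₁ p₂ m₁ (fun i => m₁ + (π' i : ℕ)) z.2 := funext fun i =>
    (hz (Sum.inr i)).1 ((freeDigits_apply_eq_iff hp₁ hp₂ π π' _ _ _).2
      (hnP _ (freePos_lt π π' _) (hPm _)))
  have h3 : ∀ i, m₁ + (π' i : ℕ) ≠ freePos π π' (Sum.inl ⟨k, by omega⟩) := fun i =>
    (freePos_injective hπ.1 hπ'.1).ne (a₁ := Sum.inr i) (by simp)
  rw [pathDiff, digitVec_setDigit_of_ne hp₁ hp₂ (fun i => by omega) h3 hu,
    digitVec_setDigit_of_ne hp₁ hp₂ (fun i => by omega) h3 hu, h2, sub_self, mul_zero, add_zero,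
    ← mul_add]
  exact congrArg _ h1

theorem permutesMod_right_of_isCCC [NeZero p₁] [NeZero p₂] (hq : 2 < p₁ * p₂)
    (hm₁ : 2 ≤ m₁) (hm₂ : 2 ≤ m₂) (hn₁ : n₁ ≤ m₁ - 1) (hn₂ : n₂ ≤ m₂ - 1)
    (hccc : ∀ (gc : ((Fin n₁ → ℕ) × (Fin n₂ → ℕ)) → Fin (m₁ - n₁) →
        ZMod (p₁ * p₂) → ZMod (p₁ * p₂)) (g'c : ((Fin n₁ → ℕ) × (Fin n₂ → ℕ)) → Fin (m₂ - n₂) →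
        ZMod (p₁ * p₂) → ZMod (p₁ * p₂)),
      IsCCC (p₁ ^ m₁ * p₂ ^ m₂) (fun t : Fin (p₁ ^ (n₁ + 1) * p₂ ^ (n₂ + 1)) =>
        psi2r p₁ p₂ m₁ m₂ n₁ n₂ hm₁ hm₂ hn₁ hn₂ J₁ J₂ fi f'i hj h'j (fun _ => π) (fun _ => π')
          gc g'c 0 0 0 t.val))
    (hπ : Function.Injective π ∧ ∀ i j, π i ≠ J₁ j)
    (hπ' : Function.Injective π' ∧ ∀ i j, π' i ≠ J₂ j) (k : Fin (m₂ - n₂ - 1)) :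
    PermutesMod (p₁ * p₂) p₂ (hj k) ∧ PermutesMod (p₁ * p₂) p₂ (h'j k) := by
  have hp₁ : 0 < p₁ := Nat.pos_of_neZero p₁
  have hp₂ : 0 < p₂ := Nat.pos_of_neZero p₂
  have hr : 0 < m₁ - n₁ := by omega
  have hr' : 0 < m₂ - n₂ := by omega
  refine permutesMod_of_sum_eq_zero (dvd_mul_left p₂ p₁) fun a ha b hb hab => ?_
  let e : Fin (m₂ - n₂) → ℕ := fun i => m₁ + π' i
  have he : Function.Injective e :=
    (add_right_injective m₁).comp (Fin.val_injective.comp hπ'.1)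
  have hlt : ∀ i, e i < m₁ + m₂ := fun i => freePos_lt π π' (Sum.inr i)
  have hrad : ∀ i, radix p₁ p₂ m₁ (e i) = p₂ := fun i => if_neg (by simp only [e]; omega)
  let P : ℕ → Prop := fun j => ∃ i : Fin (m₂ - n₂), (k : ℕ) < i ∧ j = e i
  have hPe : ∀ i, P (e i) ↔ (k : ℕ) < i := fun i =>
    ⟨fun ⟨i', h, h'⟩ => he h' ▸ h, fun h => ⟨i, h, rfl⟩⟩
  have hPm : ∀ j : Fin m₁, ¬P j := by
    rintro j ⟨i, -, h⟩
    simp only [e] at h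
    omega
  obtain ⟨w, hw₁, hw₂, hw⟩ := exists_pair_mdig_eq hp₁ hp₂ m₁ m₂ P (a := a) (b := b)
    (by rintro _ ⟨i, -, rfl⟩; rwa [hrad]) (by rintro _ ⟨i, -, rfl⟩; rwa [hrad])
  have hnP : ∀ j < m₁ + m₂, ¬P j → mdig p₁ p₂ m₁ w.1 j = mdig p₁ p₂ m₁ w.2 j := fun j hj hP => by
    rw [(hw j hj).1, (hw j hj).2, if_neg hP, if_neg hP]
  have hPeq : ∀ i, digitVec p₁ p₂ m₁ e w.1 i = digitVec p₁ p₂ m₁ e w.2 i ↔ (i : ℕ) ≤ k := by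
    intro i
    rw [digitVec_apply_eq_iff hp₁ hp₂, ← not_lt, ← hPe]
    refine ⟨fun h hP => ?_, hnP _ (hlt i)⟩
    rw [(hw _ (hlt i)).1, (hw _ (hlt i)).2, if_pos hP, if_pos hP] at h
    exact hab h
  have hmem : w ∈ similarPairs p₁ p₂ hr hr' J₁ J₂ π π' w := by
    refine mem_similarPairs_self hw₁ hw₂ (fun v => hnP _ (by omega) (hPm _))
      (fun v => hnP _ (by omega) ?_) (hnP _ (by omega) (hPm _)) (hnP _ (by omega) ?_)
    · rintro ⟨i, -, h⟩
      exact hπ'.2 i v (Fin.ext (Nat.add_left_cancel h).symm)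
    · exact (hPe ⟨0, hr'⟩).not.2 (Nat.not_lt_zero _)
  have hne : w.1 ≠ w.2 := fun h => by
    have := (hPeq ⟨k + 1, by omega⟩).1 (by rw [h])
    simp at this
  have hs := sum_similarPairs_eq_zero (hr := hr) (hr' := hr') hq hm₁ hm₂ hn₁ hn₂ hccc hw₁ hw₂ hne
  have h := sum_range_radix_eq_zero hp₁ hp₂ hπ hπ' hmem (k := Sum.inr ⟨k, by omega⟩)
    (hnP _ (hlt _) ((hPe _).not.2 (lt_irrefl _)))
    (G := fun u => ((p₁ * p₂ / p₂ : ℕ) : ZMod (p₁ * p₂)) * (hj k u * (h'j k a - h'j k b)))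
    (C := ((p₁ * p₂ / p₂ : ℕ) : ZMod (p₁ * p₂)) *
      (pathTail hj h'j k (digitVec p₁ p₂ m₁ e w.1) - pathTail hj h'j k (digitVec p₁ p₂ m₁ e w.2)))
    ?_ hs
  · rwa [show freePos π π' (Sum.inr ⟨k, by omega⟩) = e ⟨k, by omega⟩ from rfl, hrad] at h
  intro z hz u hu
  have hz := (Finset.mem_filter.1 hz).2
  have h1 := pathSum_setDigit_sub hp₁ hp₂ he hlt hj h'j k hPeq (fun i => hz (Sum.inr i)) hu
  have hk1 : P (e ⟨k + 1, by omega⟩) := (hPe _).2 (Nat.lt_succ_self _)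
  have ha' : digitVec p₁ p₂ m₁ e w.1 ⟨k + 1, by omega⟩ = a := by
    simp only [digitVec, mdigZ, (hw _ (hlt ⟨k + 1, by omega⟩)).1, if_pos hk1]
  have hb' : digitVec p₁ p₂ m₁ e w.2 ⟨k + 1, by omega⟩ = b := by
    simp only [digitVec, mdigZ, (hw _ (hlt ⟨k + 1, by omega⟩)).2, if_pos hk1]
  rw [ha', hb'] at h1
  have h2 : digitVec p₁ p₂ m₁ (fun i => (π i : ℕ)) z.1 =
      digitVec p₁ p₂ m₁ (fun i => (π i : ℕ)) z.2 := funext fun i =>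
    (hz (Sum.inl i)).1 ((freeDigits_apply_eq_iff hp₁ hp₂ π π' _ _ _).2
      (hnP _ (freePos_lt π π' _) (hPm _)))
  have h3 : ∀ i, (π i : ℕ) ≠ freePos π π' (Sum.inr ⟨k, by omega⟩) := fun i =>
    (freePos_injective hπ.1 hπ'.1).ne (a₁ := Sum.inl i) (by simp)
  rw [pathDiff, digitVec_setDigit_of_ne hp₁ hp₂ (fun i => by omega) h3 hu,
    digitVec_setDigit_of_ne hp₁ hp₂ (fun i => by omega) h3 hu, h2, sub_self, mul_zero, zero_add,
    ← mul_add]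
  exact congrArg _ h1

end

/-- Corollary 2: with `f_i, f'_i, h_j, h'_j` fixed, the family
`{ψ(C_t) : 0 ≤ t < p₁^{n₁+1}p₂^{n₂+1}}` is a `(p₁^{n₁+1}p₂^{n₂+1}, p₁^{m₁}p₂^{m₂})`-CCC
for every choice of the per-restriction data `f^{(c)}, h^{(c)}, g^{(c)}_α, g'^{(c)}_β, γ_c`
and of the bijections `π_c`, `π'_c` onto the complements of `J₁`, `J₂`, iff every
`f_i, f'_i` permutes `{0,…,p₁−1}` under reduction mod `p₁` and every `h_j, h'_j`
permutes `{0,…,p₂−1}` under reduction mod `p₂`. -/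
theorem stmt_13 (p₁ p₂ m₁ m₂ n₁ n₂ : ℕ) (hp₁ : p₁.Prime) (hp₂ : p₂.Prime)
    (hlt : p₁ < p₂) (hm₁ : 2 ≤ m₁) (hm₂ : 2 ≤ m₂)
    (hn₁ : n₁ ≤ m₁ - 1) (hn₂ : n₂ ≤ m₂ - 1)
    (J₁ : Fin n₁ → Fin m₁) (J₂ : Fin n₂ → Fin m₂)
    (hJ₁ : Function.Injective J₁) (hJ₂ : Function.Injective J₂)
    (fi f'i : Fin (m₁ - n₁ - 1) → ZMod (p₁ * p₂) → ZMod (p₁ * p₂))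
    (hj h'j : Fin (m₂ - n₂ - 1) → ZMod (p₁ * p₂) → ZMod (p₁ * p₂)) :
    (∀ (πc : ((Fin n₁ → ℕ) × (Fin n₂ → ℕ)) → Fin (m₁ - n₁) → Fin m₁)
        (π'c : ((Fin n₁ → ℕ) × (Fin n₂ → ℕ)) → Fin (m₂ - n₂) → Fin m₂)
        (gc : ((Fin n₁ → ℕ) × (Fin n₂ → ℕ)) → Fin (m₁ - n₁) →
          ZMod (p₁ * p₂) → ZMod (p₁ * p₂))
        (g'c : ((Fin n₁ → ℕ) × (Fin n₂ → ℕ)) → Fin (m₂ - n₂) →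
          ZMod (p₁ * p₂) → ZMod (p₁ * p₂))
        (fc hc : ((Fin n₁ → ℕ) × (Fin n₂ → ℕ)) → ZMod (p₁ * p₂) → ZMod (p₁ * p₂))
        (γc : ((Fin n₁ → ℕ) × (Fin n₂ → ℕ)) → ZMod (p₁ * p₂)),
        (∀ c, Function.Injective (πc c) ∧ ∀ i j, πc c i ≠ J₁ j) →
        (∀ c, Function.Injective (π'c c) ∧ ∀ i j, π'c c i ≠ J₂ j) →
        IsCCC (p₁ ^ m₁ * p₂ ^ m₂)
          (fun t : Fin (p₁ ^ (n₁ + 1) * p₂ ^ (n₂ + 1)) =>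
            psi2r p₁ p₂ m₁ m₂ n₁ n₂ hm₁ hm₂ hn₁ hn₂ J₁ J₂ fi f'i hj h'j πc π'c
              gc g'c fc hc γc t.val)) ↔
      ((∀ i, PermutesMod (p₁ * p₂) p₁ (fi i) ∧ PermutesMod (p₁ * p₂) p₁ (f'i i)) ∧
        (∀ j, PermutesMod (p₁ * p₂) p₂ (hj j) ∧ PermutesMod (p₁ * p₂) p₂ (h'j j))) := by
  have : NeZero p₁ := ⟨hp₁.ne_zero⟩
  have : NeZero p₂ := ⟨hp₂.ne_zero⟩
  constructor
  · intro h
    have hq : 2 < p₁ * p₂ := by nlinarith [hp₁.two_le, hp₂.two_le]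
    obtain ⟨π, hπ⟩ := exists_injective_compl hJ₁
    obtain ⟨π', hπ'⟩ := exists_injective_compl hJ₂
    have hccc := fun gc g'c => h (fun _ => π) (fun _ => π') gc g'c 0 0 0 (fun _ => hπ)
      (fun _ => hπ')
    exact ⟨permutesMod_left_of_isCCC hq hm₁ hm₂ hn₁ hn₂ hccc hπ hπ',
      permutesMod_right_of_isCCC hq hm₁ hm₂ hn₁ hn₂ hccc hπ hπ'⟩
  · rintro ⟨hfi, hhj⟩ πc π'c gc g'c fc hc γc hπ hπ'
    exact isCCC_psi2r hm₁ hm₂ hn₁ hn₂ hJ₁ hJ₂ hfi hhj hπ hπ'
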